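/- arXiv:math/0608666 — 2 statements merged into one kernel-verified Lean document; each statement's English description precedes it below -/
import Mathlib

section
/- Let k be a field and let n ≤ 6 be a natural number. Then every object (V,U,T) of S_k(n) admits a ℤ-grading compatible with T and U: there exists a family (V_i)_{i∈ℤ} of subspaces of V, only finitely many of which are nonzero, such that V = ⊕_{i∈ℤ} V_i (internal direct sum), T(V_i) ⊆ V_{i−1} for every i ∈ ℤ, and U = ⊕_{i∈ℤ} (U ∩ V_i). (This expresses the density of the covering functor S_k(ñ) → S_k(n) for n ≤ 6.) -/
universe u

/-- An object of the category `S_k(n)`: a finite-dimensional `k`-vector space `V`,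
a `k`-subspace `U ⊆ V`, and a linear operator `T : V → V` with `T ^ n = 0` and
`T (U) ⊆ U`. -/
structure SObj (k : Type u) [Field k] (n : ℕ) : Type (u + 1) where
  carrier : Type u
  [instAddCommGroup : AddCommGroup carrier]
  [instModule : Module k carrier]
  [instFin : FiniteDimensional k carrier]
  U : Submodule k carrier
  T : carrier →ₗ[k] carrier
  pow_eq_zero : T ^ n = 0
  maps_U : ∀ x ∈ U, T x ∈ U

namespace SObj

attribute [instance] instAddCommGroup instModule instFin

variable {k : Type u} [Field k] {n : ℕ}

/-- Isomorphism of objects of `S_k(n)`: a linear bijection intertwining the operators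
and carrying one invariant subspace onto the other. -/
def Iso (X Y : SObj k n) : Prop :=
  ∃ e : X.carrier ≃ₗ[k] Y.carrier,
    (∀ v, e (X.T v) = Y.T (e v)) ∧ X.U.map e.toLinearMap = Y.U

/-- Indecomposability: the object is nonzero and there is no decomposition
`V = V₁ ⊕ V₂` into two nonzero `T`-invariant subspaces with
`U = (U ∩ V₁) ⊕ (U ∩ V₂)`. -/
def Indec (X : SObj k n) : Prop :=
  (∃ v : X.carrier, v ≠ 0) ∧
    ¬∃ V₁ V₂ : Submodule k X.carrier,
        V₁ ≠ ⊥ ∧ V₂ ≠ ⊥ ∧ IsCompl V₁ V₂ ∧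
          (∀ x ∈ V₁, X.T x ∈ V₁) ∧ (∀ x ∈ V₂, X.T x ∈ V₂) ∧
            X.U = X.U ⊓ V₁ ⊔ X.U ⊓ V₂

/-- The dimension pair `(dim_k V, dim_k U)` of an object of `S_k(n)`. -/
noncomputable def dimPair (X : SObj k n) : ℕ × ℕ :=
  (Module.finrank k X.carrier, Module.finrank k X.U)

end SObj


namespace Cov
open Module

variable {k V : Type*} [Field k] [AddCommGroup V] [Module k V]

/-- A grading in degrees `-6..3`, given by orthogonal projections. -/
structure Gr (p : ℤ → End k V) : Prop where
  orth : ∀ i j, i ≠ j → ∀ v, p i (p j v) = 0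
  idem : ∀ i v, p i (p i v) = p i v
  sum : ∀ v, ∑ i ∈ Finset.Icc (-6 : ℤ) 3, p i v = v

/-- homogeneous operators of degree `d` -/
def Hom (p : ℤ → End k V) (d : ℤ) (A : End k V) : Prop :=
  ∀ i v, A (p i v) = p (i + d) (A v)

/-- the homogeneous component of degree `d` -/
noncomputable def comp (p : ℤ → End k V) (d : ℤ) (A : End k V) : End k V :=
  ∑ i ∈ Finset.Icc (-6 : ℤ) 3, p (i + d) * A * p i

theorem Gr.zero {p : ℤ → End k V} (h : Gr p) {i : ℤ} (hi : i < -6 ∨ 3 < i) (v : V) : p i v = 0 := by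
  rw [← h.sum v, map_sum]
  refine Finset.sum_eq_zero fun j hj => h.orth _ _ ?_ _
  rw [Finset.mem_Icc] at hj
  omega

theorem Gr.ext {p : ℤ → End k V} (h : Gr p) {v w : V} (H : ∀ i, p i v = p i w) : v = w := by
  rw [← h.sum v, ← h.sum w]
  exact Finset.sum_congr rfl fun i _ => H i

theorem Gr.apply {p : ℤ → End k V} (h : Gr p) (i j : ℤ) (v : V) :
    p i (p j v) = if i = j then p i v else 0 := by
  split_ifs with hij
  · subst hij; exact h.idem _ _
  · exact h.orth _ _ hij _

/-- elements of degree `i` have no other components -/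
theorem Gr.of_eq {p : ℤ → End k V} (h : Gr p) {i j : ℤ} {v : V} (hv : p i v = v) (hij : j ≠ i) :
    p j v = 0 := by
  rw [← hv]; exact h.orth _ _ hij _

theorem Gr.comp_apply {p : ℤ → End k V} (h : Gr p) (d : ℤ) (A : End k V) (i : ℤ) (v : V) :
    p i (comp p d A v) = p i (A (p (i - d) v)) := by
  simp only [comp, LinearMap.sum_apply, Module.End.mul_apply, map_sum, h.apply]
  by_cases hi : i - d ∈ Finset.Icc (-6 : ℤ) 3
  · rw [Finset.sum_eq_single_of_mem _ hi]
    · simp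
    · intro b _ hb
      rw [if_neg]; omega
  · rw [Finset.sum_eq_zero]
    · rw [h.zero (i := i - d), map_zero, map_zero]
      rw [Finset.mem_Icc] at hi; omega
    · intro b hb
      rw [if_neg]; rintro rfl; apply hi; simpa using hb

theorem Gr.hom_comp {p : ℤ → End k V} (h : Gr p) (d : ℤ) (A : End k V) : Hom p d (comp p d A) := by
  intro i v
  apply h.ext
  intro j
  rw [h.comp_apply, h.apply, h.apply]
  by_cases hj : j = i + d
  · subst hj; simp [h.comp_apply]
  · rw [if_neg (by omega), if_neg hj]; simp

theorem Hom.mul {p : ℤ → End k V} {d e : ℤ} {A B : End k V} (hA : Hom p d A) (hB : Hom p e B) :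
    Hom p (d + e) (A * B) := by
  intro i v
  rw [Module.End.mul_apply, Module.End.mul_apply, hB, hA]
  congr 2; ring

theorem Hom.of_eq {p : ℤ → End k V} {d e : ℤ} {A : End k V} (hA : Hom p d A) (h : d = e) :
    Hom p e A := h ▸ hA

theorem Hom.add {p : ℤ → End k V} {d : ℤ} {A B : End k V} (hA : Hom p d A) (hB : Hom p d B) :
    Hom p d (A + B) := by
  intro i v
  simp [hA i v, hB i v]

theorem Hom.sub {p : ℤ → End k V} {d : ℤ} {A B : End k V} (hA : Hom p d A) (hB : Hom p d B) :
    Hom p d (A - B) := by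
  intro i v
  simp [hA i v, hB i v]

theorem Hom.pow {p : ℤ → End k V} {A : End k V} (hA : Hom p (-1) A) (a : ℕ) :
    Hom p (-(a : ℤ)) (A ^ a) := by
  induction a with
  | zero => intro i v; simp
  | succ a ih =>
    rw [pow_succ]
    exact (ih.mul hA).of_eq (by push_cast; ring)

/-- if `v` has degree `i`, `A v` has degree `i + d` -/
theorem Hom.deg {p : ℤ → End k V} {d : ℤ} {A : End k V} (hA : Hom p d A) {i j : ℤ} {v : V}
    (hv : p i v = v) (hj : i + d = j) : p j (A v) = A v := by
  rw [← hj, ← hA, hv]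

/-- The graded object, with the vanishing and generation properties. -/
structure Good (p : ℤ → End k V) (U : Submodule k V) (T : End k V) : Prop where
  gr : Gr p
  hU : ∀ i, ∀ u ∈ U, p i u ∈ U
  hT : Hom p (-1) T
  nil : T ^ 6 = 0
  TU : ∀ u ∈ U, T u ∈ U
  b0 : ∀ i, 1 ≤ i → ∀ x, p i x = x → T x = 0 → x = 0
  b1 : ∀ x ∈ U, p 0 x = x → T x = 0 → x = 0
  b3 : ∀ x, p 3 x = x → (T ^ 5) x = 0 → x = 0
  b5 : ∀ x, p 2 x = x → T x ∈ U → x = 0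
  gen : ∀ K : ℤ → Submodule k V,
    (∀ i v, p i v = v → v ∈ K i → T v ∈ K (i - 1)) →
    (∀ i, 0 ≤ i → ∀ v, p i v = v → T v ∈ K (i - 1) → v ∈ K i) →
    (∀ v ∈ U, p (-1) v = v → T v ∈ K (-2) → v ∈ K (-1)) →
    (∀ v, p 2 v = v → (T ^ 5) v ∈ K (-3) → v ∈ K 2) →
    (∀ v, p 1 v = v → ∀ u ∈ U, p 0 u = u → T v - u ∈ K 0 → v ∈ K 1) →
    ∀ i v, p i v = v → v ∈ K i

namespace Good
variable {p : ℤ → End k V} {U : Submodule k V} {T : End k V}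

theorem pow_nil (h : Good p U T) {a : ℕ} (ha : 6 ≤ a) (x : V) : (T ^ a) x = 0 := by
  rw [pow_eq_zero_of_le ha h.nil]; rfl

theorem Tdeg (h : Good p U T) {i j : ℤ} {v : V} (hv : p i v = v) (hj : i - 1 = j) :
    p j (T v) = T v := h.hT.deg hv (by omega)

theorem powdeg (h : Good p U T) {i j : ℤ} {v : V} (a : ℕ) (hv : p i v = v) (hj : i - a = j) :
    p j ((T ^ a) v) = (T ^ a) v := (h.hT.pow a).deg hv (by omega)

theorem V4 (h : Good p U T) {i : ℤ} (hi : 4 ≤ i) {x : V} (hx : p i x = x) : x = 0 := by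
  by_cases h4 : i = 4
  · subst h4
    apply h.b0 4 (by norm_num) x hx
    apply h.b3 _ (h.Tdeg hx (by norm_num))
    rw [← Module.End.mul_apply, ← pow_succ]
    exact h.pow_nil (by norm_num) _
  · rw [← hx, h.gr.zero]; omega

theorem U2 (h : Good p U T) {i : ℤ} (hi : 2 ≤ i) {x : V} (hxU : x ∈ U) (hx : p i x = x) : x = 0 := by
  by_cases h4 : 4 ≤ i
  · exact h.V4 h4 hx
  · obtain rfl | rfl : i = 2 ∨ i = 3 := by omega
    · exact h.b5 _ hx (h.TU _ hxU)
    · apply h.b0 3 (by norm_num) x hx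
      exact h.b5 _ (h.Tdeg hx (by norm_num)) (h.TU _ (h.TU _ hxU))

theorem Uinj (h : Good p U T) {u : V} (hu : u ∈ U)
    (H : ∀ (a : ℕ) (j : ℤ), j < 0 → p j ((T ^ a) u) = 0) : u = 0 := by
  have hTU : ∀ a : ℕ, (T ^ a) u ∈ U := by
    intro a
    induction a with
    | zero => simpa
    | succ a ih => rw [pow_succ', Module.End.mul_apply]; exact h.TU _ ih
  have key : ∀ a : ℕ, (T ^ (a + 1)) u = 0 → (T ^ a) u = 0 := by
    intro a ha
    apply h.gr.ext
    intro j
    rw [map_zero]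
    by_cases hj : j < 0
    · exact H a j hj
    · have h1 : T (p j ((T ^ a) u)) = 0 := by
        rw [h.hT, ← Module.End.mul_apply (f := T), ← pow_succ', ha, map_zero]
      by_cases hj0 : j = 0
      · subst hj0
        exact h.b1 _ (h.hU _ _ (hTU a)) (h.gr.idem _ _) h1
      · exact h.b0 j (by omega) _ (h.gr.idem _ _) h1
  have := h.pow_nil (le_refl 6) u
  simpa using key 0 (key 1 (key 2 (key 3 (key 4 (key 5 this)))))

end Good

/-- The degree `d` part of the free submodule generated by degree `3`. -/
def L (p : ℤ → End k V) (T : End k V) (d : ℤ) : Submodule k V :=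
  if d ≤ 3 then (LinearMap.range (p 3)).map (T ^ (3 - d).toNat) else ⊥

namespace Good
variable {p : ℤ → End k V} {U : Submodule k V} {T : End k V}

theorem mem_L (h : Good p U T) {d : ℤ} (hd : d ≤ 3) {y : V} :
    y ∈ L p T d ↔ ∃ x, p 3 x = x ∧ (T ^ (3 - d).toNat) x = y := by
  rw [L, if_pos hd]
  constructor
  · rintro ⟨_, ⟨x, rfl⟩, rfl⟩
    exact ⟨p 3 x, h.gr.idem _ _, rfl⟩
  · rintro ⟨x, hx, rfl⟩
    exact ⟨x, ⟨x, hx⟩, rfl⟩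

theorem L_top {d : ℤ} (hd : 3 < d) {y : V} (hy : y ∈ L p T d) : y = 0 := by
  rw [L, if_neg (by omega)] at hy
  simpa using hy

theorem L_deg (h : Good p U T) {d : ℤ} {y : V} (hy : y ∈ L p T d) : p d y = y := by
  by_cases hd : d ≤ 3
  · obtain ⟨x, hx, rfl⟩ := (h.mem_L hd).1 hy
    exact h.powdeg _ hx (by omega)
  · rw [L_top (by omega) hy, map_zero]

theorem L_T (h : Good p U T) {d : ℤ} {y : V} (hy : y ∈ L p T d) : T y ∈ L p T (d - 1) := by
  by_cases hd : d ≤ 3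
  · obtain ⟨x, hx, rfl⟩ := (h.mem_L hd).1 hy
    refine (h.mem_L (by omega)).2 ⟨x, hx, ?_⟩
    rw [← Module.End.mul_apply, ← pow_succ']
    congr 2; omega
  · rw [L_top (by omega) hy, map_zero]; exact zero_mem _

theorem L_div (h : Good p U T) {d : ℤ} (hd : d ≤ 3) {y : V} (hy : y ∈ L p T (d - 1)) :
    ∃ y' ∈ L p T d, T y' = y := by
  obtain ⟨x, hx, rfl⟩ := (h.mem_L (by omega)).1 hy
  refine ⟨_, (h.mem_L hd).2 ⟨x, hx, rfl⟩, ?_⟩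
  rw [← Module.End.mul_apply, ← pow_succ']
  congr 2; omega

theorem mem_L_of_deg (h : Good p U T) {d : ℤ} (hd : 3 ≤ d) {x : V} (hx : p d x = x) :
    x ∈ L p T d := by
  by_cases h3 : d = 3
  · subst h3
    exact (h.mem_L le_rfl).2 ⟨x, hx, by simp⟩
  · rw [h.V4 (by omega) hx]; exact zero_mem _

theorem L_neg_one (h : Good p U T) {y : V} (hy : y ∈ L p T (-1)) (hTy : T y = 0) : y = 0 := by
  obtain ⟨x, hx, rfl⟩ := (h.mem_L (by norm_num)).1 hy
  have : x = 0 := by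
    apply h.b3 x hx
    rw [← Module.End.mul_apply, ← pow_succ'] at hTy
    exact hTy
  rw [this, map_zero]

/-- the test subobject -/
def K (p : ℤ → End k V) (U : Submodule k V) (T S : End k V) (s : ℤ) (i : ℤ) : Submodule k V where
  carrier := {v | ∃ y ∈ L p T (i + s), S v - y ∈ U ∧
    ∀ (a : ℕ) (j : ℤ), j < 0 → p j (S ((T ^ a) v)) = p j ((T ^ a) y)}
  zero_mem' := ⟨0, zero_mem _, by simp, by simp⟩
  add_mem' := by
    rintro v w ⟨y, hy, h1, h2⟩ ⟨z, hz, h3, h4⟩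
    refine ⟨y + z, add_mem hy hz, ?_, ?_⟩
    · have : S (v + w) - (y + z) = (S v - y) + (S w - z) := by rw [map_add]; abel
      rw [this]; exact add_mem h1 h3
    · intro a j hj
      simp only [map_add, h2 a j hj, h4 a j hj]
  smul_mem' := by
    rintro c v ⟨y, hy, h1, h2⟩
    refine ⟨c • y, Submodule.smul_mem _ _ hy, ?_, ?_⟩
    · rw [map_smul, ← smul_sub]; exact Submodule.smul_mem _ _ h1
    · intro a j hj
      simp only [map_smul, h2 a j hj]

end Good
end Cov


namespace Cov
open Module

variable {k V : Type*} [Field k] [AddCommGroup V] [Module k V]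
namespace Good
variable {p : ℤ → End k V} {U : Submodule k V} {T S : End k V} {s : ℤ}

theorem K_T (h : Good p U T) (hS2 : ∀ v, S (T v) - T (S v) ∈ U) (i : ℤ) (v : V)
    (hv : v ∈ K p U T S s i) : T v ∈ K p U T S s (i - 1) := by
  obtain ⟨y, hy, h1, h2⟩ := hv
  refine ⟨T y, ?_, ?_, ?_⟩
  · have := h.L_T hy
    rwa [show i + s - 1 = i - 1 + s by ring] at this
  · have : S (T v) - T y = (S (T v) - T (S v)) + T (S v - y) := by rw [map_sub]; abel
    rw [this]
    exact add_mem (hS2 v) (h.TU _ h1)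
  · intro a j hj
    have := h2 (a + 1) j hj
    simpa only [pow_succ, Module.End.mul_apply] using this

theorem K_t0 (h : Good p U T) (hS : Hom p s S) (hs : 2 ≤ s)
    (hS2 : ∀ v, S (T v) - T (S v) ∈ U) (i : ℤ) (hi : 0 ≤ i) (v : V) (hv : p i v = v)
    (hK : T v ∈ K p U T S s (i - 1)) : v ∈ K p U T S s i := by
  obtain ⟨y, hy, h1, h2⟩ := hK
  rw [show i - 1 + s = i + s - 1 by ring] at hy
  have hSv : p (i + s) (S v) = S v := hS.deg hv rfl
  have hTSv : T (S v) - y ∈ U := by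
    have : T (S v) - y = (S (T v) - y) - (S (T v) - T (S v)) := by abel
    rw [this]; exact sub_mem h1 (hS2 v)
  -- it suffices to have `y' = S v` with `T y' = y`
  have key : S v ∈ L p T (i + s) ∧ T (S v) = y := by
    by_cases h2' : i + s = 2
    · obtain ⟨y', hy', rfl⟩ := h.L_div (by omega) hy
      have : S v - y' = 0 := by
        apply h.b5
        · rw [map_sub, ← h2', hSv, h.L_deg hy']
        · rwa [map_sub]
      rw [sub_eq_zero] at this
      rw [this]; exact ⟨hy', rfl⟩
    · refine ⟨h.mem_L_of_deg (by omega) hSv, ?_⟩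
      rw [← sub_eq_zero]
      apply h.U2 (i := i + s - 1) (by omega) hTSv
      rw [map_sub, h.Tdeg hSv rfl, h.L_deg hy]
  refine ⟨S v, key.1, by simp, ?_⟩
  intro a j hj
  cases a with
  | zero => simp
  | succ a =>
    have := h2 a j hj
    rw [← key.2] at this
    simpa only [pow_succ, Module.End.mul_apply] using this

theorem comm_pow (h : Good p U T) (hS1 : ∀ u ∈ U, S (T u) = T (S u)) (a : ℕ) :
    ∀ u ∈ U, S ((T ^ a) u) = (T ^ a) (S u) := by
  induction a with
  | zero => simp
  | succ a ih =>
    intro u hu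
    simp only [pow_succ, Module.End.mul_apply]
    rw [ih _ (h.TU _ hu), hS1 _ hu]

theorem K_t1 (h : Good p U T) (hS : Hom p s S) (hs : 2 ≤ s)
    (hS1 : ∀ u ∈ U, S (T u) = T (S u)) (v : V) (hvU : v ∈ U) (hv : p (-1) v = v)
    (hK : T v ∈ K p U T S s (-2)) : v ∈ K p U T S s (-1) := by
  obtain ⟨y, hy, h1, h2⟩ := hK
  have hSv : p (-1 + s) (S v) = S v := hS.deg hv rfl
  have hTSv : T (S v) = y := by
    rw [← hS1 _ hvU, ← sub_eq_zero]
    apply h.Uinj h1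
    intro a j hj
    rw [map_sub, map_sub, ← h.comm_pow hS1 a _ (h.TU _ hvU), h2 a j hj, sub_self]
  rw [show -2 + s = -1 + s - 1 by ring] at hy
  have key : S v ∈ L p T (-1 + s) := by
    by_cases h3 : -1 + s ≤ 3
    · obtain ⟨y', hy', h'⟩ := h.L_div h3 hy
      have : S v - y' = 0 := by
        apply h.b0 (-1 + s) (by omega)
        · rw [map_sub, hSv, h.L_deg hy']
        · rw [map_sub, hTSv, h', sub_self]
      rw [sub_eq_zero] at this
      rwa [this]
    · exact h.mem_L_of_deg (by omega) hSv
  refine ⟨S v, key, by simp, ?_⟩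
  intro a j hj
  rw [h.comm_pow hS1 a _ hvU]

theorem K_t3 (h : Good p U T) (hS : Hom p s S) (hs : 2 ≤ s) (v : V) (hv : p 2 v = v)
    (hK : (T ^ 5) v ∈ K p U T S s (-3)) : v ∈ K p U T S s 2 := by
  obtain ⟨y, hy, h1, h2⟩ := hK
  have hSv : S v = 0 := h.V4 (i := 2 + s) (by omega) (hS.deg hv rfl)
  refine ⟨0, zero_mem _, by simp [hSv], ?_⟩
  intro a j hj
  rw [map_zero, map_zero]
  have hdeg : p (2 - a + s) (S ((T ^ a) v)) = S ((T ^ a) v) := hS.deg (h.powdeg a hv rfl) rfl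
  by_cases hja : j = 2 - a + s
  swap
  · exact h.gr.of_eq hdeg hja
  by_cases ha : 6 ≤ a
  · rw [h.pow_nil ha]; simp
  have ha5 : a = 5 := by omega
  subst ha5
  have hs2 : s = 2 := by push_cast at hja; omega
  subst hs2
  have hy0 : y = 0 := by
    apply h.L_neg_one hy
    have h3 := h2 1 (-2) (by norm_num)
    rw [← Module.End.mul_apply (f := T ^ 1), ← pow_add, h.pow_nil (by norm_num)] at h3
    rw [pow_one, map_zero, map_zero, h.Tdeg (h.L_deg hy) (by norm_num)] at h3
    exact h3.symm
  have h4 := h2 0 j hj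
  rw [hy0] at h4
  simpa using h4

theorem K_t5 (h : Good p U T) (hS : Hom p s S) (hs : 2 ≤ s)
    (hS1 : ∀ u ∈ U, S (T u) = T (S u)) (hS2 : ∀ v, S (T v) - T (S v) ∈ U)
    (v : V) (hv : p 1 v = v) (u : V) (hu : u ∈ U) (hu0 : p 0 u = u)
    (hK : T v - u ∈ K p U T S s 0) : v ∈ K p U T S s 1 := by
  obtain ⟨y, hy, h1, h2⟩ := hK
  have hSv : p (1 + s) (S v) = S v := hS.deg hv rfl
  have hTv : p 0 (T v) = T v := h.Tdeg hv (by norm_num)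
  have e1 : S (T v - u) = y := by
    rw [← sub_eq_zero]
    apply h.U2 (i := 0 + s) (by omega) h1
    rw [map_sub, hS.deg _ rfl, h.L_deg hy]
    rw [map_sub, hTv, hu0]
  have e2 : S (T v) = T (S v) := by
    rw [← sub_eq_zero]
    apply h.U2 (i := 0 + s) (by omega) (hS2 v)
    rw [map_sub, hS.deg hTv rfl, h.Tdeg hSv (by ring)]
  refine ⟨S v, h.mem_L_of_deg (by omega) hSv, by simp, ?_⟩
  intro a j hj
  cases a with
  | zero => simp
  | succ a =>
    have h3 := h2 a j hj
    simp only [pow_succ, Module.End.mul_apply]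
    rw [map_sub, map_sub, map_sub, ← e1, h.comm_pow hS1 a _ hu] at h3
    rw [map_sub, map_sub, map_sub, e2] at h3
    exact sub_left_injective h3

theorem K_all (h : Good p U T) (hS : Hom p s S) (hs : 2 ≤ s)
    (hS1 : ∀ u ∈ U, S (T u) = T (S u)) (hS2 : ∀ v, S (T v) - T (S v) ∈ U)
    (i : ℤ) (v : V) (hv : p i v = v) : v ∈ K p U T S s i :=
  h.gen (K p U T S s) (fun i v _ => h.K_T hS2 i v) (h.K_t0 hS hs hS2) (h.K_t1 hS hs hS1)
    (h.K_t3 hS hs) (h.K_t5 hS hs hS1 hS2) i v hv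

/-- uniqueness of the element `y` -/
theorem y_unique (h : Good p U T) {v y z : V}
    (hy : S v - y ∈ U) (hy2 : ∀ (a : ℕ) (j : ℤ), j < 0 → p j (S ((T ^ a) v)) = p j ((T ^ a) y))
    (hz : S v - z ∈ U) (hz2 : ∀ (a : ℕ) (j : ℤ), j < 0 → p j (S ((T ^ a) v)) = p j ((T ^ a) z)) :
    y = z := by
  rw [← sub_eq_zero]
  apply h.Uinj
  · have : y - z = (S v - z) - (S v - y) := by abel
    rw [this]; exact sub_mem hz hy
  · intro a j hj
    rw [map_sub, map_sub, ← hy2 a j hj, ← hz2 a j hj, sub_self]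

/-- `S` is a norm up to maps `V → U → 0` -/
theorem norm (h : Good p U T) (hS : Hom p s S) (hs : 2 ≤ s)
    (hS1 : ∀ u ∈ U, S (T u) = T (S u)) (hS2 : ∀ v, S (T v) - T (S v) ∈ U) :
    ∃ R : End k V, (∀ v, S v - (∑ a ∈ Finset.range 6, T ^ a * R * T ^ (5 - a)) v ∈ U) ∧
      (∀ u ∈ U, S u = (∑ a ∈ Finset.range 6, T ^ a * R * T ^ (5 - a)) u) := by
  let G : Submodule k (V × V) :=
    { carrier := {q | p 3 q.2 = q.2 ∧ S (p (-2 - s) q.1) - (T ^ 5) q.2 ∈ U ∧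
        ∀ (a : ℕ) (j : ℤ), j < 0 →
          p j (S ((T ^ a) (p (-2 - s) q.1))) = p j ((T ^ a) ((T ^ 5) q.2))}
      zero_mem' := by simp
      add_mem' := by
        rintro ⟨v, y⟩ ⟨w, z⟩ ⟨h0, h1, h2⟩ ⟨h0', h3, h4⟩
        refine ⟨by simp only [Prod.mk_add_mk, map_add] at *; rw [h0, h0'], ?_, ?_⟩
        · have := add_mem h1 h3
          simp only [Prod.mk_add_mk, map_add] at *
          convert this using 1; abel
        · intro a j hj
          have e1 := h2 a j hj
          have e2 := h4 a j hj
          simp only [Prod.mk_add_mk, map_add] at *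
          rw [e1, e2]
      smul_mem' := by
        rintro c ⟨v, y⟩ ⟨h0, h1, h2⟩
        refine ⟨by simp only [Prod.smul_mk, map_smul] at *; rw [h0], ?_, ?_⟩
        · have := Submodule.smul_mem _ c h1
          simp only [Prod.smul_mk, map_smul, smul_sub] at *
          exact this
        · intro a j hj
          have e1 := h2 a j hj
          simp only [Prod.smul_mk, map_smul] at *
          rw [e1] }
  have hsurj : LinearMap.range ((LinearMap.fst k V V).comp G.subtype) = ⊤ := by
    rw [LinearMap.range_eq_top]
    intro v
    obtain ⟨y, hy, h1, h2⟩ := h.K_all hS hs hS1 hS2 (-2 - s) (p (-2 - s) v) (h.gr.idem _ _)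
    rw [show -2 - s + s = -2 by ring] at hy
    obtain ⟨x, hx, rfl⟩ := (h.mem_L (by norm_num)).1 hy
    exact ⟨⟨(v, x), hx, h1, h2⟩, rfl⟩
  obtain ⟨f, hf⟩ := LinearMap.exists_rightInverse_of_surjective _ hsurj
  let R0 : End k V := (LinearMap.snd k V V).comp (G.subtype.comp f)
  have hR0 : ∀ v, (v, R0 v) ∈ G := by
    intro v
    have h1 : (f v : V × V).1 = v := LinearMap.congr_fun hf v
    have h2 : ((v, R0 v) : V × V) = f v := Prod.ext h1.symm rfl
    rw [h2]; exact (f v).2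
  let R : End k V := R0 * p (-2 - s)
  -- value of the norm on homogeneous elements
  have key : ∀ i v, p i v = v → ∀ y ∈ L p T (i + s), S v - y ∈ U →
      (∀ (a : ℕ) (j : ℤ), j < 0 → p j (S ((T ^ a) v)) = p j ((T ^ a) y)) →
      (∑ a ∈ Finset.range 6, T ^ a * R * T ^ (5 - a)) v = y := by
    intro i v hv y hy h1 h2
    have hterm : ∀ a ∈ Finset.range 6, (a : ℤ) ≠ 3 - s - i →
        (T ^ a * R * T ^ (5 - a)) v = 0 := by
      intro a ha hne
      rw [Finset.mem_range] at ha
      have : p (-2 - s) ((T ^ (5 - a)) v) = 0 :=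
        h.gr.of_eq (h.powdeg _ hv rfl) (by omega)
      simp [R, this]
    rw [LinearMap.sum_apply]
    by_cases hi : i + s ≤ 3
    swap
    · rw [L_top (by omega) hy, Finset.sum_eq_zero]
      intro a ha
      exact hterm a ha (by omega)
    obtain ⟨x, hx, rfl⟩ := (h.mem_L hi).1 hy
    by_cases hi2 : -2 ≤ i + s
    swap
    · rw [h.pow_nil (by omega), Finset.sum_eq_zero]
      intro a ha
      rw [Finset.mem_range] at ha
      exact hterm a (Finset.mem_range.2 ha) (by omega)
    obtain ⟨a, ha⟩ : ∃ a : ℕ, (a : ℤ) = 3 - (i + s) := ⟨(3 - (i + s)).toNat, by omega⟩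
    have hat : (3 - (i + s)).toNat = a := by omega
    have ha5 : a ≤ 5 := by omega
    rw [hat] at hy h1 h2 ⊢
    rw [Finset.sum_eq_single_of_mem a (Finset.mem_range.2 (by omega))]
    swap
    · intro b hb hba
      exact hterm b hb (by omega)
    have hw : p (-2 - s) ((T ^ (5 - a)) v) = (T ^ (5 - a)) v := h.powdeg _ hv (by omega)
    have hRx : R ((T ^ (5 - a)) v) = x := by
      obtain ⟨g0, g1, g2⟩ := hR0 ((T ^ (5 - a)) v)
      simp only [hw] at g0 g1 g2
      have e5 : (T ^ 5) x = (T ^ (5 - a)) ((T ^ a) x) := by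
        rw [← Module.End.mul_apply, ← pow_add]; congr 2; omega
      have : (T ^ 5) (R0 ((T ^ (5 - a)) v)) = (T ^ 5) x := by
        apply h.y_unique g1 g2
        · rw [e5]
          -- membership for the iterate
          have : ∀ b : ℕ, S ((T ^ b) v) - (T ^ b) ((T ^ a) x) ∈ U := by
            intro b
            induction b with
            | zero => simpa using h1
            | succ b ih =>
              have e : S ((T ^ (b + 1)) v) - (T ^ (b + 1)) ((T ^ a) x) =
                  (S (T ((T ^ b) v)) - T (S ((T ^ b) v))) +
                    T (S ((T ^ b) v) - (T ^ b) ((T ^ a) x)) := by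
                simp only [pow_succ', Module.End.mul_apply, map_sub]; abel
              rw [e]
              exact add_mem (hS2 _) (h.TU _ ih)
          exact this _
        · intro b j hj
          have := h2 (b + (5 - a)) j hj
          rw [e5]
          simpa only [pow_add, Module.End.mul_apply] using this
      have h3 : R0 ((T ^ (5 - a)) v) - x = 0 := by
        apply h.b3
        · rw [map_sub, g0, hx]
        · rw [map_sub, this, sub_self]
      simp only [R, Module.End.mul_apply, hw]
      exact sub_eq_zero.1 h3
    simp only [Module.End.mul_apply, hRx]
  refine ⟨R, ?_, ?_⟩
  · intro v
    rw [← h.gr.sum v]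
    simp only [map_sum]
    rw [← Finset.sum_sub_distrib]
    refine sum_mem fun i _ => ?_
    obtain ⟨y, hy, h1, h2⟩ := h.K_all hS hs hS1 hS2 i (p i v) (h.gr.idem _ _)
    rw [key i _ (h.gr.idem _ _) y hy h1 h2]
    exact h1
  · intro u hu
    rw [← h.gr.sum u]
    simp only [map_sum]
    refine Finset.sum_congr rfl fun i _ => ?_
    obtain ⟨y, hy, h1, h2⟩ := h.K_all hS hs hS1 hS2 i (p i u) (h.gr.idem _ _)
    rw [key i _ (h.gr.idem _ _) y hy h1 h2, ← sub_eq_zero]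
    apply h.Uinj h1
    intro a j hj
    rw [map_sub, map_sub, ← h2 a j hj, h.comm_pow hS1 a _ (h.hU _ _ hu), sub_self]

end Good
end Cov


namespace Cov
open Module

variable {k V : Type*} [Field k] [AddCommGroup V] [Module k V] [FiniteDimensional k V]

theorem tr_rank_one (f : V →ₗ[k] k) (x : V) (N : End k V) :
    LinearMap.trace k V (f.smulRight x * N) = f (N x) := by
  have : f.smulRight x * N = (f.comp N).smulRight x := by ext v; simp
  rw [this, LinearMap.trace_smulRight]; rfl

theorem exists_dual {W : Submodule k V} {x : V} (hx : x ∉ W) :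
    ∃ f : V →ₗ[k] k, f x ≠ 0 ∧ ∀ w ∈ W, f w = 0 := by
  obtain ⟨f, hf, hW⟩ := Submodule.exists_le_ker_of_notMem hx
  exact ⟨f, hf, fun w hw => hW hw⟩

/-- trace duality -/
theorem exists_trace_repr (φ : End k V →ₗ[k] k) : ∃ S : End k V, ∀ A, φ A = LinearMap.trace k V (A * S) := by
  let Φ : End k V →ₗ[k] (End k V →ₗ[k] k) :=
    LinearMap.mk₂ k (fun S A => LinearMap.trace k V (A * S)) (by intros; simp [mul_add]) (by intros; simp)
      (by intros; simp [add_mul]) (by intros; simp)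
  have hinj : Function.Injective Φ := by
    rw [injective_iff_map_eq_zero]
    intro S hS
    ext v
    by_contra hv
    obtain ⟨f, hf, -⟩ := exists_dual (W := (⊥ : Submodule k V)) (x := S v) (by simpa using hv)
    apply hf
    rw [← tr_rank_one f v S]
    exact LinearMap.congr_fun hS (f.smulRight v)
  have hsurj : Function.Surjective Φ :=
    (LinearMap.injective_iff_surjective_of_finrank_eq_finrank
      (Subspace.dual_finrank_eq (K := k) (V := End k V)).symm).1 hinj
  obtain ⟨S, hS⟩ := hsurj φ
  exact ⟨S, fun A => by rw [← hS]; rfl⟩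

/-- pairing of a homogeneous operator with an arbitrary one -/
theorem Gr.tr_comp {p : ℤ → End k V} (h : Gr p) {d : ℤ} {A : End k V} (hA : Hom p (-d) A)
    (S : End k V) : LinearMap.trace k V (A * comp p d S) = LinearMap.trace k V (A * S) := by
  have h1 : A * S = ∑ i ∈ Finset.Icc (-6 : ℤ) 3, p i * (A * S) := by
    ext v
    simp only [LinearMap.sum_apply, Module.End.mul_apply]
    exact (h.sum _).symm
  rw [h1, comp, Finset.mul_sum, map_sum, map_sum]
  refine Finset.sum_congr rfl fun i _ => ?_
  rw [← mul_assoc, ← mul_assoc, LinearMap.trace_mul_comm, ← mul_assoc, ← mul_assoc,  ← mul_assoc]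
  congr 2
  ext v
  simp only [Module.End.mul_apply]
  rw [hA, show i + d + -d = i by ring, h.idem]

theorem Gr.comp_mem {p : ℤ → End k V} {U : Submodule k V} (hU : ∀ i, ∀ u ∈ U, p i u ∈ U)
    {d : ℤ} {A : End k V} (hA : ∀ u ∈ U, A u ∈ U) : ∀ u ∈ U, comp p d A u ∈ U := by
  intro u hu
  simp only [comp, LinearMap.sum_apply, Module.End.mul_apply]
  exact sum_mem fun i _ => hU _ _ (hA _ (hU _ _ hu))

theorem tr_sq_zero {U : Submodule k V} {A : End k V} (h1 : ∀ v, A v ∈ U) (h2 : ∀ u ∈ U, A u = 0) :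
    LinearMap.trace k V A = 0 := by
  have : IsNilpotent A := ⟨2, by ext v; simp [pow_two, h2 _ (h1 v)]⟩
  exact (LinearMap.isNilpotent_trace_of_isNilpotent this).eq_zero

namespace Good
variable {p : ℤ → End k V} {U : Submodule k V} {T : End k V}

theorem solve (h : Good p U T) {m : ℤ} (hm : 1 ≤ m) {E : End k V} (hE : Hom p (-1 - m) E)
    (hEU : ∀ u ∈ U, E u ∈ U) (hnorm : ∑ a ∈ Finset.range 6, T ^ (5 - a) * E * T ^ a = 0) :
    ∃ D : End k V, Hom p (-m) D ∧ (∀ u ∈ U, D u ∈ U) ∧ T * D - D * T = E := by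
  let P : Submodule k (End k V) :=
    { carrier := {D | Hom p (-m) D ∧ ∀ u ∈ U, D u ∈ U}
      zero_mem' := ⟨fun i v => by simp, by simp⟩
      add_mem' := fun ha hb => ⟨ha.1.add hb.1, fun u hu => add_mem (ha.2 u hu) (hb.2 u hu)⟩
      smul_mem' := fun c A hA => ⟨fun i v => by simp [hA.1 i v],
        fun u hu => Submodule.smul_mem _ _ (hA.2 u hu)⟩ }
  let ad : End k V →ₗ[k] End k V := LinearMap.mulLeft k T - LinearMap.mulRight k T
  by_contra hcon
  have hnot : E ∉ P.map ad := by
    rintro ⟨D, ⟨hD, hDU⟩, rfl⟩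
    exact hcon ⟨D, hD, hDU, rfl⟩
  obtain ⟨φ, hφE, hφ⟩ := exists_dual hnot
  obtain ⟨S0, hS0⟩ := exists_trace_repr φ
  let s := 1 + m
  let S := comp p s S0
  have hS : Hom p s S := h.gr.hom_comp _ _
  have hES : LinearMap.trace k V (E * S) ≠ 0 := by
    rw [h.gr.tr_comp (hE.of_eq (by ring)), ← hS0]; exact hφE
  let N := S * T - T * S
  have hN : Hom p m N :=
    ((hS.mul h.hT).of_eq (by ring)).sub ((h.hT.mul hS).of_eq (by ring))
  have hDN : ∀ D : End k V, (∀ u ∈ U, D u ∈ U) → LinearMap.trace k V (D * N) = 0 := by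
    intro D hD
    have hc := h.gr.hom_comp (-m) D
    have e1 : LinearMap.trace k V (D * N) = LinearMap.trace k V (comp p (-m) D * N) := by
      rw [LinearMap.trace_mul_comm, ← h.gr.tr_comp (d := -m) (hN.of_eq (by ring)),
        LinearMap.trace_mul_comm]
    rw [e1]
    set C := comp p (-m) D
    have hT' := h.hT
    have e2 : LinearMap.trace k V (C * N) = LinearMap.trace k V ((T * C - C * T) * S) := by
      simp only [N, mul_sub, sub_mul, map_sub]
      have : LinearMap.trace k V (C * (S * T)) = LinearMap.trace k V (T * C * S) := by
        rw [← mul_assoc, LinearMap.trace_mul_comm, mul_assoc]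
      rw [this, mul_assoc C T S]
    rw [e2, h.gr.tr_comp, ← hS0]
    · exact hφ _ ⟨C, ⟨hc, Gr.comp_mem h.hU hD⟩, rfl⟩
    exact ((h.hT.mul hc).of_eq (by ring)).sub ((hc.mul h.hT).of_eq (by ring))
  have hN1 : ∀ u ∈ U, N u = 0 := by
    intro u hu
    by_contra hne
    obtain ⟨f, hf, -⟩ := exists_dual (W := (⊥ : Submodule k V)) (x := N u) (by simpa using hne)
    apply hf
    rw [← tr_rank_one]
    apply hDN
    intro w _
    exact Submodule.smul_mem _ _ hu
  have hN2 : ∀ v, N v ∈ U := by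
    intro v
    by_contra hne
    obtain ⟨f, hf, hfU⟩ := exists_dual hne
    apply hf
    rw [← tr_rank_one]
    apply hDN
    intro w hw
    simp [hfU w hw]
  obtain ⟨R, hR1, hR2⟩ := h.norm hS (by omega)
    (fun u hu => by simpa [N, sub_eq_zero] using hN1 u hu) hN2
  set Q := ∑ a ∈ Finset.range 6, T ^ a * R * T ^ (5 - a) with hQ
  apply hES
  have e1 : LinearMap.trace k V (E * (S - Q)) = 0 := by
    apply tr_sq_zero (U := U)
    · intro v; exact hEU _ (hR1 v)
    · intro u hu
      simp [hR2 u hu]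
  have e2 : LinearMap.trace k V (E * Q) = 0 := by
    have : LinearMap.trace k V (E * Q) = LinearMap.trace k V ((∑ a ∈ Finset.range 6, T ^ (5 - a) * E * T ^ a) * R) := by
      rw [hQ, Finset.mul_sum, Finset.sum_mul, map_sum, map_sum]
      refine Finset.sum_congr rfl fun a _ => ?_
      rw [← mul_assoc, LinearMap.trace_mul_comm]
      simp only [mul_assoc]
    rw [this, hnorm, zero_mul, map_zero]
  rw [mul_sub, map_sub, e2, sub_zero] at e1
  exact e1

end Good
end Cov


namespace Cov
open Module

variable {k V : Type*} [Field k] [AddCommGroup V] [Module k V] [FiniteDimensional k V]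

/-- Admissible filtrations. -/
structure Adm (U : Submodule k V) (T : End k V) (F : ℤ → Submodule k V) : Prop where
  mono : ∀ i, F i ≤ F (i + 1)
  tm : ∀ i, ∀ x ∈ F i, T x ∈ F (i - 1)
  c0 : ∀ i, 0 ≤ i → ∀ x, T x ∈ F (i - 1) → x ∈ F i
  c1 : ∀ x ∈ U, T x ∈ F (-2) → x ∈ F (-1)
  c3 : ∀ x, (T ^ 5) x ∈ F (-3) → x ∈ F 2
  c5 : ∀ x, ∀ u ∈ U, T x - u ∈ F 0 → x ∈ F 1

/-- The filtration given by a grading. -/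
def Fil (p : ℤ → End k V) (i : ℤ) : Submodule k V where
  carrier := {x | ∀ j, i < j → p j x = 0}
  zero_mem' := by simp
  add_mem' := fun ha hb j hj => by rw [map_add, ha j hj, hb j hj, add_zero]
  smul_mem' := fun c x hx j hj => by rw [map_smul, hx j hj, smul_zero]

theorem Fil_mono {p : ℤ → End k V} {i j : ℤ} (hij : i ≤ j) : Fil p i ≤ Fil p j :=
  fun _ hx l hl => hx l (by omega)

/-- operators of degree at most `d` -/
def Low (p : ℤ → End k V) (d : ℤ) (A : End k V) : Prop :=
  ∀ i, ∀ x ∈ Fil p i, A x ∈ Fil p (i + d)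

section
variable {p : ℤ → End k V} {d e : ℤ} {A B : End k V}

theorem Low.mul (hA : Low p d A) (hB : Low p e B) : Low p (d + e) (A * B) := by
  intro i x hx
  have := hA _ _ (hB i x hx)
  rwa [show i + e + d = i + (d + e) by ring] at this

theorem Low.add (hA : Low p d A) (hB : Low p d B) : Low p d (A + B) :=
  fun i x hx => add_mem (hA i x hx) (hB i x hx)

theorem Low.sub (hA : Low p d A) (hB : Low p d B) : Low p d (A - B) :=
  fun i x hx => sub_mem (hA i x hx) (hB i x hx)

theorem Low.le (hA : Low p d A) (h : d ≤ e) : Low p e A :=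
  fun i x hx => Fil_mono (by omega) (hA i x hx)

theorem Low.one : Low p 0 (1 : End k V) := fun i x hx => by simpa using hx

theorem Low.zero : Low p d (0 : End k V) := fun i x _ => by simp

theorem Low.pow (hA : Low p (-1) A) (a : ℕ) : Low p (-(a : ℤ)) (A ^ a) := by
  induction a with
  | zero => simpa using Low.one
  | succ a ih => rw [pow_succ]; exact (ih.mul hA).le (by push_cast; omega)

theorem Low.pow_sub {m : ℤ} (hA : Low p (-1) A) (hB : Low p (-1) B) (h : Low p (-1 - m) (A - B))
    (a : ℕ) : Low p (-(a : ℤ) - m) (A ^ a - B ^ a) := by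
  induction a with
  | zero => simpa using Low.zero
  | succ a ih =>
    have : A ^ (a + 1) - B ^ (a + 1) = A ^ a * (A - B) + (A ^ a - B ^ a) * B := by
      rw [pow_succ, pow_succ]; noncomm_ring
    rw [this]
    exact (((hA.pow a).mul h).le (by push_cast; omega)).add ((ih.mul hB).le (by push_cast; omega))

theorem Gr.mem_Fil (h : Gr p) {i j : ℤ} {x : V} (hx : p i x = x) (hij : i ≤ j) : x ∈ Fil p j :=
  fun l hl => h.of_eq hx (by omega)

theorem Gr.low_of_hom (h : Hom p d A) : Low p d A := by
  intro i x hx j hj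
  have := h (j - d) x
  rw [hx _ (by omega), map_zero] at this
  rw [show j - d + d = j by ring] at this
  exact this.symm

theorem Gr.low_sub_comp (h : Gr p) (hA : Low p d A) : Low p (d - 1) (A - comp p d A) := by
  intro i x hx j hj
  rw [LinearMap.sub_apply, map_sub, h.comp_apply, ← map_sub, ← map_sub]
  by_cases hj' : i + d < j
  · rw [hx (j - d) (by omega), sub_zero]
    exact hA i x hx j hj'
  · obtain rfl : j = i + d := by omega
    refine hA (i - 1) _ ?_ _ (by omega)
    intro l hl
    rw [map_sub, h.apply]
    split_ifs with hli
    · rw [sub_self]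
    · rw [hx l (by omega), sub_zero]

theorem Gr.hom_low_zero (h : Gr p) (hA : Hom p d A) (hl : Low p (d - 1) A) : A = 0 := by
  have key : ∀ i v, A (p i v) = 0 := by
    intro i v
    have h1 := hl i (p i v) (h.mem_Fil (h.idem _ _) le_rfl) (i + d) (by omega)
    rwa [hA.deg (h.idem _ _) rfl] at h1
  ext v
  rw [← h.sum v, map_sum]
  simp [key]
end

/-- The associated graded object of a minimal admissible filtration. -/
theorem good_of_adm {p : ℤ → End k V} {U : Submodule k V} {T : End k V} (h : Gr p)
    (hU : ∀ i, ∀ u ∈ U, p i u ∈ U) (hTU : ∀ u ∈ U, T u ∈ U) (hnil : T ^ 6 = 0)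
    (adm : Adm U T (Fil p))
    (hmin : ∀ F, Adm U T F → (∀ i, F i ≤ Fil p i) → ∀ i, Fil p i ≤ F i) :
    Good p U (comp p (-1) T) ∧ Low p (-2) (T - comp p (-1) T) := by
  have hTl : Low p (-1) T := fun i x hx => adm.tm i x hx
  set T0 := comp p (-1) T with hT0
  have hT0h : Hom p (-1) T0 := h.hom_comp _ _
  have hT0l : Low p (-1) T0 := Gr.low_of_hom hT0h
  have hdl : Low p (-1 - 1) (T - T0) := h.low_sub_comp hTl
  have hdm : Low p (-2) (T - T0) := hdl
  have hnil0 : T0 ^ 6 = 0 := by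
    apply h.hom_low_zero (hT0h.pow 6)
    have := hTl.pow_sub hT0l hdl 6
    rw [hnil] at this
    have h2 := Low.zero.sub this (p := p)
    simpa using h2
  -- leading terms
  have lead : ∀ i x, x ∈ Fil p i → p (i - 1) (T x) = T0 (p i x) := by
    intro i x hx
    have h1 := hdm i x hx (i - 1) (by omega)
    rw [LinearMap.sub_apply, map_sub, sub_eq_zero] at h1
    rw [h1, hT0h]; rfl
  have lead5 : ∀ i x, x ∈ Fil p i → p (i - 5) ((T ^ 5) x) = (T0 ^ 5) (p i x) := by
    intro i x hx
    have h1 := hTl.pow_sub hT0l hdl 5 i x hx (i - 5) (by push_cast; omega)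
    rw [LinearMap.sub_apply, map_sub, sub_eq_zero] at h1
    rw [h1, hT0h.pow 5]; rfl
  have drop : ∀ i x, p i x = x → x ∈ Fil p (i - 1) → x = 0 := by
    intro i x hx hm
    rw [← hx]; exact hm i (by omega)
  refine ⟨⟨h, hU, hT0h, hnil0, Gr.comp_mem hU hTU, ?_, ?_, ?_, ?_, ?_⟩, hdm⟩
  · intro i hi x hx hTx
    apply drop i x hx
    apply adm.c0 _ (by omega)
    have h1 := hdm i x (h.mem_Fil hx le_rfl)
    rw [LinearMap.sub_apply, hTx, sub_zero] at h1
    exact Fil_mono (by omega) h1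
  · intro x hxU hx hTx
    apply drop 0 x hx
    apply adm.c1 x hxU
    have h1 := hdm 0 x (h.mem_Fil hx le_rfl)
    rw [LinearMap.sub_apply, hTx, sub_zero] at h1
    exact h1
  · intro x hx hTx
    apply drop 3 x hx
    apply adm.c3 x
    have h1 := hTl.pow_sub hT0l hdl 5 3 x (h.mem_Fil hx le_rfl)
    rw [LinearMap.sub_apply, hTx, sub_zero] at h1
    exact h1
  · intro x hx hTx
    apply drop 2 x hx
    apply adm.c5 x _ hTx
    exact hdm 2 x (h.mem_Fil hx le_rfl)
  · intro K hK t0 t1 t3 t5 i v hv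
    let F : ℤ → Submodule k V := fun i => Fil p i ⊓ (K i).comap (p i)
    have hF : ∀ i x, x ∈ F i ↔ x ∈ Fil p i ∧ p i x ∈ K i := fun i x => Iff.rfl
    have hFadm : Adm U T F := by
      refine ⟨?_, ?_, ?_, ?_, ?_, ?_⟩
      · intro i x hx
        refine ⟨Fil_mono (by omega) hx.1, ?_⟩
        change p (i + 1) x ∈ K (i + 1)
        rw [hx.1 (i + 1) (by omega)]; exact zero_mem _
      · intro i x hx
        refine ⟨adm.tm i x hx.1, ?_⟩
        change p (i - 1) (T x) ∈ K (i - 1)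
        rw [lead i x hx.1]
        exact hK i _ (h.idem _ _) hx.2
      · intro i hi x hx
        have hxi := adm.c0 i hi x hx.1
        refine ⟨hxi, t0 i hi _ (h.idem _ _) ?_⟩
        rw [← lead i x hxi]; exact hx.2
      · intro x hxU hx
        have hxi := adm.c1 x hxU hx.1
        refine ⟨hxi, t1 _ (hU _ _ hxU) (h.idem _ _) ?_⟩
        rw [← lead (-1) x hxi]; exact hx.2
      · intro x hx
        have hxi := adm.c3 x hx.1
        refine ⟨hxi, t3 _ (h.idem _ _) ?_⟩
        rw [← lead5 2 x hxi]; exact hx.2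
      · intro x u hu hx
        have hxi := adm.c5 x u hu hx.1
        refine ⟨hxi, t5 _ (h.idem _ _) (p 0 u) (hU _ _ hu) (h.idem _ _) ?_⟩
        rw [← lead 1 x hxi]
        have := hx.2
        change p 0 (T x - u) ∈ K 0 at this
        rw [map_sub] at this
        exact this
    have h1 := hmin F hFadm (fun i => inf_le_left) i (h.mem_Fil hv le_rfl)
    have h2 : p i v ∈ K i := h1.2
    rwa [hv] at h2

end Cov


namespace Cov
open Module

variable {k V : Type*} [Field k] [AddCommGroup V] [Module k V] [FiniteDimensional k V]

/-- the minimal admissible filtration -/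
theorem exists_min (U : Submodule k V) (T : End k V) (hnil : T ^ 6 = 0) :
    ∃ F, Adm U T F ∧ F (-7) = ⊥ ∧ F 3 = ⊤ ∧
      ∀ F', Adm U T F' → (∀ i, F' i ≤ F i) → ∀ i, F i ≤ F' i := by
  let F : ℤ → Submodule k V := fun i => ⨅ G : {G // Adm U T G}, G.1 i
  have hmem : ∀ i x, x ∈ F i ↔ ∀ G, Adm U T G → x ∈ G i := by
    intro i x
    simp only [F, Submodule.mem_iInf, Subtype.forall]
  have hF : Adm U T F := by
    refine ⟨?_, ?_, ?_, ?_, ?_, ?_⟩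
    · intro i x hx
      rw [hmem] at *
      exact fun G hG => hG.mono i (hx G hG)
    · intro i x hx
      rw [hmem] at *
      exact fun G hG => hG.tm i x (hx G hG)
    · intro i hi x hx
      rw [hmem] at *
      exact fun G hG => hG.c0 i hi x (hx G hG)
    · intro x hxU hx
      rw [hmem] at *
      exact fun G hG => hG.c1 x hxU (hx G hG)
    · intro x hx
      rw [hmem] at *
      exact fun G hG => hG.c3 x (hx G hG)
    · intro x u hu hx
      rw [hmem] at *
      exact fun G hG => hG.c5 x u hu (hx G hG)
  refine ⟨F, hF, ?_, ?_, ?_⟩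
  · let G : ℤ → Submodule k V := fun i => LinearMap.range (T ^ (-1 - i).toNat)
    have htop : ∀ i, -1 ≤ i → ∀ x, x ∈ G i := by
      intro i hi x
      exact ⟨x, by rw [show (-1 - i).toNat = 0 by omega]; simp⟩
    have hG : Adm U T G := by
      refine ⟨?_, ?_, fun i hi x _ => htop i (by omega) x, fun x _ _ => htop _ (by omega) x,
        fun x _ => htop _ (by omega) x, fun x _ _ _ => htop _ (by omega) x⟩
      · intro i x hx
        by_cases hi : -1 ≤ i + 1
        · exact htop _ hi _
        · obtain ⟨y, rfl⟩ := hx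
          refine ⟨T y, ?_⟩
          rw [← Module.End.mul_apply, ← pow_succ]
          congr 2; omega
      · intro i x hx
        by_cases hi : -1 ≤ i - 1
        · exact htop _ hi _
        · obtain ⟨y, rfl⟩ := hx
          by_cases hi2 : -1 ≤ i
          · obtain rfl : i = -1 := by omega
            refine ⟨y, ?_⟩
            simp
          · refine ⟨y, ?_⟩
            rw [← Module.End.mul_apply, ← pow_succ']
            congr 2; omega
    rw [eq_bot_iff]
    intro x hx
    obtain ⟨y, rfl⟩ := (hmem _ _).1 hx G hG
    change (T ^ 6) y ∈ _
    rw [hnil]; simp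
  · rw [eq_top_iff]
    intro x _
    apply hF.c0 3 (by norm_num)
    apply hF.c3
    rw [← Module.End.mul_apply, ← pow_succ, hnil]
    exact zero_mem _
  · intro F' hF' _ i x hx
    exact (hmem i x).1 hx F' hF'

/-- a projection onto `A` preserving `U` -/
theorem exists_proj (A U : Submodule k V) :
    ∃ r : End k V, (∀ v, r v ∈ A) ∧ (∀ v ∈ A, r v = v) ∧ ∀ u ∈ U, r u ∈ U := by
  obtain ⟨q, hq⟩ := Submodule.exists_isCompl (A ⊓ U)
  have hd : Disjoint A (q ⊓ U) := by
    rw [Submodule.disjoint_def]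
    intro x hx hx2
    exact Submodule.disjoint_def.1 hq.disjoint x ⟨hx, hx2.2⟩ hx2.1
  obtain ⟨C, hC, hAC⟩ := hd.symm.exists_isCompl
  refine ⟨A.projection C hAC.symm, fun v => Submodule.projection_apply_mem _ _,
    fun v hv => Submodule.projection_apply_of_mem_left _ hv, fun u hu => ?_⟩
  have h1 : u = (A ⊓ U).projection q hq u + (u - (A ⊓ U).projection q hq u) := by abel
  have h2 : (A ⊓ U).projection q hq u ∈ A ⊓ U := Submodule.projection_apply_mem _ _
  have h3 : u - (A ⊓ U).projection q hq u ∈ q ⊓ U :=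
    ⟨Submodule.sub_projection_mem _ _, U.sub_mem hu h2.2⟩
  rw [h1, map_add, Submodule.projection_apply_of_mem_left _ h2.1,
    (Submodule.projection_apply_eq_zero_iff _).2 (hC h3), add_zero]
  exact h2.2

theorem exists_q (U : Submodule k V) (F : ℤ → Submodule k V) (hm : Monotone F)
    (htop : F 3 = ⊤) : ∃ q : ℤ → End k V, (∀ i, -7 ≤ i → ∀ v, q i v ∈ F i) ∧
      (∀ i, ∀ v ∈ F i, q i v = v) ∧ (∀ i j, i ≤ j → ∀ v, q i (q j v) = q i v) ∧
      (∀ i, ∀ u ∈ U, q i u ∈ U) := by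
  choose r r1 r2 r3 using fun i => exists_proj (F i) U
  let Q : ℕ → End k V := fun n => Nat.rec 1 (fun n A => r (3 - (n + 1 : ℤ)) * A) n
  have Q0 : Q 0 = 1 := rfl
  have Qs : ∀ n v, Q (n + 1) v = r (3 - (n + 1 : ℤ)) (Q n v) := fun n v => rfl
  have hQ1 : ∀ (n : ℕ) v, Q n v ∈ F (3 - (n : ℤ)) := by
    intro n v
    cases n with
    | zero => simp [htop]
    | succ n => rw [Qs]; push_cast; exact r1 _ _
  have hQ2 : ∀ n : ℕ, ∀ v ∈ F (3 - (n : ℤ)), Q n v = v := by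
    intro n
    induction n with
    | zero => intro v _; rfl
    | succ n ih =>
      intro v hv
      push_cast at hv
      rw [Qs, ih v (hm (by omega) hv), r2 _ _ hv]
  have hQ3 : ∀ n j v, Q (n + j) (Q n v) = Q (n + j) v := by
    intro n j v
    induction j with
    | zero => exact hQ2 _ _ (hQ1 _ _)
    | succ j ih => rw [← add_assoc, Qs, ih, Qs]
  have hQ4 : ∀ n, ∀ u ∈ U, Q n u ∈ U := by
    intro n
    induction n with
    | zero => intro u hu; exact hu
    | succ n ih => intro u hu; rw [Qs]; exact r3 _ _ (ih u hu)
  have hF : ∀ i, F (3 - ((3 - i).toNat : ℤ)) = F i := by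
    intro i
    by_cases hi : i ≤ 3
    · congr 1; omega
    · rw [show (3 - ((3 - i).toNat : ℤ)) = 3 by omega, htop]
      exact (top_le_iff.1 (htop ▸ hm (by omega : (3:ℤ) ≤ i))).symm
  refine ⟨fun i => Q (3 - i).toNat, fun i _ v => ?_, fun i v hv => ?_, fun i j hij v => ?_,
    fun i => hQ4 _⟩
  · rw [← hF]; exact hQ1 _ _
  · rw [← hF] at hv; exact hQ2 _ _ hv
  · obtain ⟨a, ha⟩ : ∃ a, (3 - i).toNat = (3 - j).toNat + a := ⟨(3 - i).toNat - (3 - j).toNat, by omega⟩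
    simp only [ha]
    exact hQ3 _ _ _

theorem exists_gr (U : Submodule k V) (F : ℤ → Submodule k V) (hm : Monotone F)
    (hbot : F (-7) = ⊥) (htop : F 3 = ⊤) :
    ∃ p : ℤ → End k V, Gr p ∧ (∀ i, ∀ u ∈ U, p i u ∈ U) ∧ ∀ i, Fil p i = F i := by
  obtain ⟨q, q1, q2, q3, q4⟩ := exists_q U F hm htop
  have qbot : ∀ v, q (-7) v = 0 := by
    intro v
    have := q1 (-7) le_rfl v
    rwa [hbot, Submodule.mem_bot] at this
  have qtop : ∀ i, 3 ≤ i → ∀ v, q i v = v := by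
    intro i hi v
    exact q2 i v (hm hi (by rw [htop]; trivial))
  have qlow : ∀ i, i ≤ -7 → ∀ v, q i v = 0 := by
    intro i hi v
    rw [← q3 i (-7) hi, qbot, map_zero]
  have q1' : ∀ i v, q i v ∈ F i := by
    intro i v
    by_cases hi : -7 ≤ i
    · exact q1 i hi v
    · rw [qlow i (by omega)]; exact zero_mem _
  have q3' : ∀ i j, i ≤ j → ∀ v, q j (q i v) = q i v := fun i j hij v =>
    q2 j _ (hm hij (q1' i v))
  let p : ℤ → End k V := fun i => q i - q (i - 1)
  have hp : ∀ i v, p i v = q i v - q (i - 1) v := fun i v => rfl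
  have hgr : Gr p := by
    refine ⟨?_, ?_, ?_⟩
    · intro i j hij v
      simp only [hp, map_sub]
      rcases lt_or_gt_of_ne hij with h | h
      · rw [q3 i j (by omega), q3 (i-1) j (by omega), q3 i (j-1) (by omega),
          q3 (i-1) (j-1) (by omega)]
        abel
      · rw [q3' j i (by omega), q3' j (i-1) (by omega), q3' (j-1) i (by omega),
          q3' (j-1) (i-1) (by omega)]
        abel
    · intro i v
      simp only [hp, map_sub]
      rw [q3 i i le_rfl, q3 (i-1) i (by omega), q3' (i-1) i (by omega), q3 (i-1) (i-1) le_rfl]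
      abel
    · intro v
      have : Finset.Icc (-6:ℤ) 3 = {-6,-5,-4,-3,-2,-1,0,1,2,3} := by decide
      rw [this]
      simp only [hp]
      have h3 := qtop 3 le_rfl v
      have h7 := qbot v
      norm_num [h3, h7]
  refine ⟨p, hgr, fun i u hu => U.sub_mem (q4 _ _ hu) (q4 _ _ hu), fun i => le_antisymm ?_ ?_⟩
  · intro x hx
    have key : ∀ n : ℕ, q (i + n) x = q i x := by
      intro n
      induction n with
      | zero => simp
      | succ n ih =>
        have := hx (i + n + 1) (by omega)
        rw [hp, sub_eq_zero, add_sub_cancel_right, ih] at this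
        push_cast
        rw [← add_assoc]; exact this
    have h1 := key (3 - i).toNat
    rw [qtop _ (by omega)] at h1
    rw [h1]; exact q1' _ _
  · intro x hx j hj
    rw [hp, q2 j x (hm (by omega) hx), q2 (j-1) x (hm (by omega) hx), sub_self]

end Cov


namespace Cov
open Module

variable {k V : Type*} [Field k] [AddCommGroup V] [Module k V] [FiniteDimensional k V]

theorem Low.sum {p : ℤ → End k V} {d : ℤ} {n : ℕ} {f : ℕ → End k V}
    (h : ∀ a < n, Low p d (f a)) : Low p d (∑ a ∈ Finset.range n, f a) := by
  induction n with
  | zero => simpa using Low.zero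
  | succ n ih =>
    rw [Finset.sum_range_succ]
    exact (ih fun a ha => h a (by omega)).add (h n (by omega))

theorem Hom.sum {p : ℤ → End k V} {d : ℤ} {n : ℕ} {f : ℕ → End k V}
    (h : ∀ a < n, Hom p d (f a)) : Hom p d (∑ a ∈ Finset.range n, f a) := by
  induction n with
  | zero => intro i v; simp
  | succ n ih =>
    rw [Finset.sum_range_succ]
    exact (ih fun a ha => h a (by omega)).add (h n (by omega))

theorem Gr.low_zero {p : ℤ → End k V} (h : Gr p) {d : ℤ} (hd : d ≤ -10) {A : End k V}
    (hA : Low p d A) : A = 0 := by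
  ext v
  apply h.ext
  intro i
  rw [LinearMap.zero_apply, map_zero]
  have h3 : v ∈ Fil p 3 := fun j hj => h.zero (Or.inr hj) v
  by_cases hi : i < -6
  · exact h.zero (Or.inl hi) _
  · exact hA 3 v h3 i (by omega)

theorem step {p : ℤ → End k V} {U : Submodule k V} {T T' : End k V} (h : Good p U T) {m : ℤ}
    (hm : 1 ≤ m) (hnil : T' ^ 6 = 0) (hTU : ∀ u ∈ U, T' u ∈ U) (hl : Low p (-1 - m) (T' - T)) :
    ∃ g g' S : End k V, g * g' = 1 ∧ g' * g = 1 ∧ (∀ u ∈ U, g u ∈ U) ∧ (∀ u ∈ U, g' u ∈ U) ∧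
      T' * g = g * S ∧ S ^ 6 = 0 ∧ (∀ u ∈ U, S u ∈ U) ∧ Low p (-1 - (m + 1)) (S - T) := by
  have hTl : Low p (-1) T := Gr.low_of_hom h.hT
  have hT'l : Low p (-1) T' := by
    have := (hl.le (by omega : -1 - m ≤ -1)).add hTl
    rwa [sub_add_cancel] at this
  obtain ⟨E, hE⟩ : ∃ E, E = comp p (-1 - m) (T' - T) := ⟨_, rfl⟩
  have hEh : Hom p (-1 - m) E := hE ▸ h.gr.hom_comp _ _
  have hEU : ∀ u ∈ U, E u ∈ U := by
    rw [hE]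
    exact Gr.comp_mem h.hU fun u hu => U.sub_mem (hTU u hu) (h.TU u hu)
  have hR : Low p (-2 - m) (T' - T - E) := by
    rw [hE]
    exact (h.gr.low_sub_comp hl).le (by omega)
  have hnorm : ∑ a ∈ Finset.range 6, T ^ (5 - a) * E * T ^ a = 0 := by
    have htel : ∑ a ∈ Finset.range 6, T ^ (5 - a) * (T' - T) * T' ^ a = 0 := by
      have : ∑ a ∈ Finset.range 6, T ^ (5 - a) * (T' - T) * T' ^ a = T' ^ 6 - T ^ 6 := by
        simp only [Finset.sum_range_succ, Finset.sum_range_zero]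
        norm_num
        noncomm_ring
      rw [this, hnil, h.nil, sub_zero]
    apply h.gr.hom_low_zero (d := -6 - m)
    · apply Hom.sum
      intro a ha
      refine (((h.hT.pow (5 - a)).mul hEh).mul (h.hT.pow a)).of_eq ?_
      push_cast [Nat.cast_sub (show a ≤ 5 by omega)]
      ring
    · rw [← sub_zero (∑ a ∈ Finset.range 6, T ^ (5 - a) * E * T ^ a), ← htel,
        ← Finset.sum_sub_distrib]
      apply Low.sum
      intro a ha
      have e : T ^ (5 - a) * E * T ^ a - T ^ (5 - a) * (T' - T) * T' ^ a =
          0 - (T ^ (5 - a) * (T' - T - E) * T ^ a + T ^ (5 - a) * (T' - T) * (T' ^ a - T ^ a)) := by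
        noncomm_ring
      rw [e]
      have c : ((5 - a : ℕ) : ℤ) = 5 - a := by push_cast [Nat.cast_sub (show a ≤ 5 by omega)]; rfl
      refine Low.zero.sub (Low.add ?_ ?_)
      · exact (((hTl.pow (5 - a)).mul hR).mul (hTl.pow a)).le (by rw [c]; omega)
      · exact (((hTl.pow (5 - a)).mul hl).mul (hT'l.pow_sub hTl hl a)).le (by rw [c]; omega)
  obtain ⟨D, hD, hDU, hDE⟩ := h.solve hm hEh hEU hnorm
  have hDm : Low p (-m) D := Gr.low_of_hom hD
  have hDl : Low p (-1) D := hDm.le (by omega)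
  have hD10 : D ^ 10 = 0 := h.gr.low_zero le_rfl (hDl.pow 10)
  obtain ⟨g', hg'⟩ : ∃ g', g' = ∑ i ∈ Finset.range 10, D ^ i := ⟨_, rfl⟩
  have h1 : (1 - D) * g' = 1 := by rw [hg', mul_neg_geom_sum, hD10, sub_zero]
  have h2 : g' * (1 - D) = 1 := by rw [hg', geom_sum_mul_neg, hD10, sub_zero]
  have hg'l : Low p 0 g' := by
    rw [hg']
    exact Low.sum fun a _ => (hDl.pow a).le (by omega)
  have hgU : ∀ u ∈ U, (1 - D) u ∈ U := fun u hu => U.sub_mem hu (hDU u hu)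
  have hDpU : ∀ a : ℕ, ∀ u ∈ U, (D ^ a) u ∈ U := by
    intro a
    induction a with
    | zero => intro u hu; simpa using hu
    | succ a ih => intro u hu; rw [pow_succ, Module.End.mul_apply]; exact ih _ (hDU u hu)
  have hg'U : ∀ u ∈ U, g' u ∈ U := by
    intro u hu
    rw [hg', LinearMap.sum_apply]
    exact sum_mem fun a _ => hDpU a u hu
  have hS : T' * (1 - D) = (1 - D) * (g' * T' * (1 - D)) := by
    rw [← mul_assoc, ← mul_assoc, h1, one_mul]
  refine ⟨1 - D, g', g' * T' * (1 - D), h1, h2, hgU, hg'U, hS, ?_, ?_, ?_⟩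
  · have : SemiconjBy (1 - D) (g' * T' * (1 - D)) T' := hS.symm
    have h6 := this.pow_right 6
    rw [hnil] at h6
    have h7 : (1 - D) * (g' * T' * (1 - D)) ^ 6 = 0 := h6.eq.trans (zero_mul _)
    have h8 := congrArg (fun A => g' * A) h7
    simp only [← mul_assoc g' (1 - D), h2, one_mul, mul_zero] at h8
    exact h8
  · intro u hu
    exact hg'U _ (hTU _ (hgU u hu))
  · have e : g' * T' * (1 - D) - T = g' * ((T' - T - E) - (T' - T) * D) := by
      have e1 : T = g' * ((1 - D) * T) := by rw [← mul_assoc, h2, one_mul]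
      have e2 : g' * T' * (1 - D) - T = g' * T' * (1 - D) - g' * ((1 - D) * T) := by rw [← e1]
      rw [e2, ← hDE]
      noncomm_ring
    rw [e]
    exact (hg'l.mul ((hR.le (by omega)).sub ((hl.mul hDm).le (by omega)))).le
      (show 0 + (-2 - m) ≤ -1 - (m + 1) by omega)

theorem iter {p : ℤ → End k V} {U : Submodule k V} {T T' : End k V} (h : Good p U T)
    (hnil : T' ^ 6 = 0) (hTU : ∀ u ∈ U, T' u ∈ U) (hl : Low p (-2) (T' - T)) (m : ℕ) :
    ∃ g g' S : End k V, g * g' = 1 ∧ g' * g = 1 ∧ (∀ u ∈ U, g u ∈ U) ∧ (∀ u ∈ U, g' u ∈ U) ∧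
      T' * g = g * S ∧ S ^ 6 = 0 ∧ (∀ u ∈ U, S u ∈ U) ∧ Low p (-1 - ((m : ℤ) + 1)) (S - T) := by
  induction m with
  | zero => exact ⟨1, 1, T', by simp, by simp, by simp, by simp, by simp, hnil, hTU, hl.le (by simp)⟩
  | succ m ih =>
    obtain ⟨g, g', S, h1, h2, h3, h4, h5, h6, h7, h8⟩ := ih
    obtain ⟨f, f', S', i1, i2, i3, i4, i5, i6, i7, i8⟩ := step h (by omega) h6 h7 h8
    refine ⟨g * f, f' * g', S', ?_, ?_, fun u hu => h3 _ (i3 u hu), fun u hu => i4 _ (h4 u hu), ?_,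
      i6, i7, i8.le (by push_cast; omega)⟩
    · rw [mul_assoc, ← mul_assoc f, i1, one_mul, h1]
    · rw [mul_assoc, ← mul_assoc g', h2, one_mul, i2]
    · rw [← mul_assoc, h5, mul_assoc, i5, mul_assoc]

/-- Every nilpotent operator with invariant subspace, of nilpotency index at most six, is gradable. -/
theorem exists_grading (U : Submodule k V) (T : End k V) (hnil : T ^ 6 = 0)
    (hTU : ∀ u ∈ U, T u ∈ U) :
    ∃ p : ℤ → End k V, Gr p ∧ (∀ i, ∀ u ∈ U, p i u ∈ U) ∧ Hom p (-1) T := by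
  obtain ⟨F, hF, hbot, htop, hmin⟩ := exists_min U T hnil
  obtain ⟨p, hp, hU, hFil⟩ := exists_gr U F (monotone_int_of_le_succ hF.mono) hbot htop
  obtain rfl : Fil p = F := funext hFil
  obtain ⟨good, hl⟩ := good_of_adm hp hU hTU hnil hF hmin
  obtain ⟨g, g', S, h1, h2, h3, h4, h5, -, -, h8⟩ := iter good hnil hTU hl 8
  have hS : S = comp p (-1) T := sub_eq_zero.1 (hp.low_zero (by norm_num) h8)
  have hSh : Hom p (-1) S := hS ▸ good.hT
  have e1 : ∀ v, g (g' v) = v := fun v => by rw [← Module.End.mul_apply, h1]; rfl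
  have e2 : ∀ v, g' (g v) = v := fun v => by rw [← Module.End.mul_apply, h2]; rfl
  have e3 : ∀ v, T (g v) = g (S v) := fun v => LinearMap.congr_fun h5 v
  refine ⟨fun i => g * p i * g', ⟨?_, ?_, ?_⟩, fun i u hu => h3 _ (hU _ _ (h4 _ hu)), ?_⟩
  · intro i j hij v
    simp only [Module.End.mul_apply, e2, hp.orth i j hij, map_zero]
  · intro i v
    simp only [Module.End.mul_apply, e2, hp.idem]
  · intro v
    simp only [Module.End.mul_apply]
    rw [← map_sum, hp.sum, e1]
  · intro i v
    simp only [Module.End.mul_apply]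
    rw [e3, hSh]
    have : g' (T v) = S (g' v) := by
      conv_lhs => rw [← e1 v, e3, e2]
    rw [this]

theorem exists_decomp (U : Submodule k V) (T : End k V) (hnil : T ^ 6 = 0)
    (hTU : ∀ u ∈ U, T u ∈ U) :
    ∃ g : ℤ → Submodule k V, iSupIndep g ∧ (⨆ i, g i) = ⊤ ∧ {i : ℤ | g i ≠ ⊥}.Finite ∧
      (∀ i : ℤ, ∀ x ∈ g i, T x ∈ g (i - 1)) ∧ U = ⨆ i : ℤ, U ⊓ g i := by
  obtain ⟨p, hp, hU, hT⟩ := exists_grading U T hnil hTU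
  have hker : ∀ i x, p i x ∈ LinearMap.range (p i) := fun i x => ⟨x, rfl⟩
  refine ⟨fun i => LinearMap.range (p i), ?_, ?_, ?_, ?_, ?_⟩
  · rw [iSupIndep_def]
    intro i
    rw [Submodule.disjoint_def]
    rintro _ ⟨x, rfl⟩ hx
    have hle : (⨆ j, ⨆ (_ : j ≠ i), LinearMap.range (p j)) ≤ LinearMap.ker (p i) := by
      refine iSup_le fun j => iSup_le fun hj => ?_
      rintro _ ⟨y, rfl⟩
      exact hp.orth _ _ (Ne.symm hj) _
    have := hle hx
    rwa [LinearMap.mem_ker, hp.idem] at this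
  · rw [eq_top_iff]
    intro x _
    rw [← hp.sum x]
    exact sum_mem fun i _ => Submodule.mem_iSup_of_mem i (hker i x)
  · refine (Finset.Icc (-6 : ℤ) 3).finite_toSet.subset fun i hi => ?_
    by_contra hc
    apply hi
    rw [LinearMap.range_eq_bot]
    ext v
    apply hp.zero
    simp only [Finset.coe_Icc, Set.mem_Icc] at hc
    omega
  · rintro i _ ⟨x, rfl⟩
    exact ⟨T x, by rw [hT]; rfl⟩
  · apply le_antisymm
    · intro u hu
      rw [← hp.sum u]
      exact sum_mem fun i _ => Submodule.mem_iSup_of_mem i ⟨hU i u hu, hker i u⟩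
    · exact iSup_le fun i => inf_le_left

end Cov

/-- (Density of the covering functor for `n ≤ 6`.)  Every object `(V,U,T)` of `S_k(n)`
with `n ≤ 6` admits a ℤ-grading compatible with `T` and `U`: there are subspaces
`V_i ⊆ V` (`i ∈ ℤ`), only finitely many nonzero, with `V = ⊕_i V_i`,
`T(V_i) ⊆ V_{i−1}` and `U = ⊕_i (U ∩ V_i)`. -/
theorem stmt9 (k : Type u) [Field k] (n : ℕ) (hn : n ≤ 6) (X : SObj k n) :
    ∃ g : ℤ → Submodule k X.carrier,
      iSupIndep g ∧
      (⨆ i, g i) = ⊤ ∧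
      {i : ℤ | g i ≠ ⊥}.Finite ∧
      (∀ i : ℤ, ∀ x ∈ g i, X.T x ∈ g (i - 1)) ∧
      X.U = ⨆ i : ℤ, X.U ⊓ g i := by
  exact Cov.exists_decomp X.U X.T (pow_eq_zero_of_le hn X.pow_eq_zero) X.maps_U
end

section
/- Let k be a field and let M be an indecomposable object of S_k(ñ) with n = 6. Then the support of M is contained in an interval of 8 consecutive indices: there exists ℓ ∈ ℤ such that M_i = 0 and M_{i'} = 0 for all i ∉ {ℓ, ℓ+1, …, ℓ+7}. -/
universe u

/-- An object of the covering category `S_k(ñ)`, encoded as an object `(V,U,T)` of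
`S_k(n)` together with a ℤ-grading `V = ⊕_{i∈ℤ} V_i` (finitely many nonzero pieces)
such that `T(V_i) ⊆ V_{i−1}` and `U = ⊕_i (U ∩ V_i)`.  Here `V_i` plays the role of
the vector space `M_i` and `U ∩ V_i` the role of (the image under the inclusion
`β_i` of) the vector space `M_{i'}`. -/
structure SCovObj (k : Type u) [Field k] (n : ℕ) extends SObj k n where
  grading : ℤ → Submodule k carrier
  indep : iSupIndep grading
  iSup_grading : (⨆ i, grading i) = ⊤
  finite_support : {i : ℤ | grading i ≠ ⊥}.Finite
  T_grading : ∀ i : ℤ, ∀ x ∈ grading i, T x ∈ grading (i - 1)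
  U_grading : U = ⨆ i : ℤ, U ⊓ grading i

namespace SCovObj

variable {k : Type u} [Field k] {n : ℕ}

/-- Indecomposability in the covering category: the object is nonzero and admits no direct
decomposition into two nonzero graded subobjects compatible with `T` and `U`. -/
def Indec (M : SCovObj k n) : Prop :=
  (∃ v : M.carrier, v ≠ 0) ∧
    ¬∃ V₁ V₂ : Submodule k M.carrier,
        V₁ ≠ ⊥ ∧ V₂ ≠ ⊥ ∧ IsCompl V₁ V₂ ∧
          (∀ x ∈ V₁, M.T x ∈ V₁) ∧ (∀ x ∈ V₂, M.T x ∈ V₂) ∧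
            M.U = M.U ⊓ V₁ ⊔ M.U ⊓ V₂ ∧
            V₁ = (⨆ j, V₁ ⊓ M.grading j) ∧ V₂ = (⨆ j, V₂ ⊓ M.grading j)

/-- `x_i = dim_k M_i`, the total-space part of the dimension vector, as an integer. -/
noncomputable def a (M : SCovObj k n) (i : ℤ) : ℤ :=
  (Module.finrank k (M.grading i) : ℤ)

/-- `x_{i'} = dim_k M_{i'}`, the subspace part of the dimension vector, as an integer. -/
noncomputable def b (M : SCovObj k n) (i : ℤ) : ℤ :=
  (Module.finrank k ↥(M.U ⊓ M.grading i) : ℤ)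

/-- The quadratic form `χ` (for `n = 6`) evaluated at the dimension vector of `M`. -/
noncomputable def chi (M : SCovObj k n) : ℤ :=
  ∑ᶠ i : ℤ,
    (M.a i ^ 2 + M.b i ^ 2 - M.a i * M.a (i + 1) - M.b i * M.b (i + 1)
      - M.b i * M.a i + M.a i * M.a (i + 6) + M.b i * M.b (i + 6) + M.b (i + 1) * M.a i)

/-- `π(x)`, first component: `Σ_i dim_k M_i`. -/
noncomputable def piV (M : SCovObj k n) : ℕ :=
  ∑ᶠ i : ℤ, Module.finrank k (M.grading i)

/-- `π(x)`, second component: `Σ_i dim_k M_{i'}`. -/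
noncomputable def piU (M : SCovObj k n) : ℕ :=
  ∑ᶠ i : ℤ, Module.finrank k ↥(M.U ⊓ M.grading i)

/-- `t(x) = #{i ∈ ℤ : M_i ≠ 0}`, the size of the support of the total space. -/
noncomputable def tsupp (M : SCovObj k n) : ℕ :=
  {i : ℤ | M.grading i ≠ ⊥}.ncard

end SCovObj

namespace Cov

variable {k : Type*} {V : Type*} [Field k] [AddCommGroup V] [Module k V]

/-- A graded, `T`-stable family of subspaces of the graded space `G`. -/
structure IsFam (T : V →ₗ[k] V) (G K : ℤ → Submodule k V) : Prop where
  le : ∀ i, K i ≤ G i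
  stable : ∀ i, ∀ x ∈ K i, T x ∈ K (i - 1)

/-- Homogeneous elements `v` of degree `t` that may be added to the family `K`. -/
def Elem (T : V →ₗ[k] V) (U : Submodule k V) (G K : ℤ → Submodule k V) (t : ℤ) (v : V) : Prop :=
  v ∈ G t ∧ (8 ≤ t ∨ (t = 5 ∧ T v ∈ K 4) ∨ (t = 6 ∧ T v ∈ (U ⊓ G 5) ⊔ K 5) ∨
    (t = 7 ∧ (T ^ 5) v ∈ K 2) ∨ (t = 4 ∧ v ∈ U ∧ T v ∈ K 3))

/-- Add the cyclic submodule generated by `v` (in degree `t`) to the family `K`. -/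
def step_s10 (T : V →ₗ[k] V) (K : ℤ → Submodule k V) (t : ℤ) (v : V) : ℤ → Submodule k V :=
  fun i => K i ⊔ Submodule.span k {x | ∃ n : ℕ, i = t - n ∧ x = (T ^ n) v}

/-- Families obtained from zero by successively adding elementary elements. -/
inductive Reach (T : V →ₗ[k] V) (U : Submodule k V) (G : ℤ → Submodule k V) :
    (ℤ → Submodule k V) → Prop
  | bot : Reach T U G (fun _ => ⊥)
  | step_s10 (K : ℤ → Submodule k V) (t : ℤ) (v : V) : Reach T U G K → Elem T U G K t v →
      Reach T U G (step_s10 T K t v)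

/-- `Z` is a graded `T`-stable family meeting `N` in `K`, spanning together with `N`,
compatibly with `U`. -/
structure Good_s10 (T : V →ₗ[k] V) (U : Submodule k V) (G N K Z : ℤ → Submodule k V) : Prop where
  fam : IsFam T G Z
  inf : ∀ i, Z i ⊓ N i = K i
  sup : ∀ i, G i ≤ Z i ⊔ N i
  U_le : ∀ i, U ⊓ G i ≤ (U ⊓ Z i) ⊔ (U ⊓ N i)

variable {T : V →ₗ[k] V} {U : Submodule k V} {G N K Z : ℤ → Submodule k V}

lemma pow_succ_app (n : ℕ) (x : V) : T ((T ^ n) x) = (T ^ (n + 1)) x := by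
  rw [pow_succ', Module.End.mul_apply]

lemma pow_add_app (m n : ℕ) (x : V) : (T ^ m) ((T ^ n) x) = (T ^ (m + n)) x := by
  rw [pow_add, Module.End.mul_apply]

lemma pow_zero_of_six (hT6 : T ^ 6 = 0) {n : ℕ} (hn : 6 ≤ n) (x : V) : (T ^ n) x = 0 := by
  obtain ⟨m, rfl⟩ := Nat.exists_eq_add_of_le hn
  rw [pow_add, hT6, zero_mul]; rfl

lemma IsFam.pow (hK : IsFam T G K) (n : ℕ) {i j : ℤ} (hj : j = i - n) {x : V} (hx : x ∈ K i) :
    (T ^ n) x ∈ K j := by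
  induction n generalizing j with
  | zero => simp at hj; subst hj; simpa using hx
  | succ n ih =>
    have := hK.stable _ _ (ih (j := i - n) rfl)
    rw [pow_succ_app] at this
    have e : j = i - n - 1 := by rw [hj]; push_cast; ring
    rw [e]; exact this

lemma pow_U (hTU : ∀ x ∈ U, T x ∈ U) (n : ℕ) {x : V} (hx : x ∈ U) : (T ^ n) x ∈ U := by
  induction n with
  | zero => simpa using hx
  | succ n ih => rw [← pow_succ_app]; exact hTU _ ih

lemma mem_step {t : ℤ} {v : V} {i : ℤ} {x : V} {n : ℕ} (hi : i = t - n)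
    (hx : x ∈ step_s10 T K t v i) : ∃ y ∈ K i, ∃ a : k, x = y + a • (T ^ n) v := by
  have hs : {x | ∃ n : ℕ, i = t - n ∧ x = (T ^ n) v} = {(T ^ n) v} := by
    ext z
    simp only [Set.mem_setOf_eq, Set.mem_singleton_iff]
    constructor
    · rintro ⟨m, hm, rfl⟩
      have : m = n := by omega
      rw [this]
    · rintro rfl; exact ⟨n, hi, rfl⟩
  unfold step_s10 at hx
  rw [hs] at hx
  obtain ⟨y, hy, z, hz, rfl⟩ := Submodule.mem_sup.1 hx
  obtain ⟨a, rfl⟩ := Submodule.mem_span_singleton.1 hz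
  exact ⟨y, hy, a, rfl⟩

lemma mem_step_gt {t : ℤ} {v : V} {i : ℤ} {x : V} (hi : t < i)
    (hx : x ∈ step_s10 T K t v i) : x ∈ K i := by
  have hs : {x | ∃ n : ℕ, i = t - n ∧ x = (T ^ n) v} = ∅ := by
    ext z
    simp only [Set.mem_setOf_eq, Set.mem_empty_iff_false, iff_false]
    rintro ⟨m, hm, -⟩
    omega
  unfold step_s10 at hx
  rw [hs] at hx
  simpa using hx

lemma le_step {t : ℤ} {v : V} (i : ℤ) : K i ≤ step_s10 T K t v i := le_sup_left

lemma pow_mem_step {t : ℤ} {v : V} {i : ℤ} (n : ℕ) (hi : i = t - n) :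
    (T ^ n) v ∈ step_s10 T K t v i :=
  Submodule.mem_sup_right (Submodule.subset_span ⟨n, hi, rfl⟩)

lemma IsFam.step_s10 (hG : IsFam T G G) (hK : IsFam T G K) {t : ℤ} {v : V} (hv : v ∈ G t) :
    IsFam T G (step_s10 T K t v) where
  le i := by
    refine sup_le (hK.le i) (Submodule.span_le.2 ?_)
    rintro x ⟨n, hi, rfl⟩
    exact hG.pow n hi hv
  stable i x hx := by
    rcases lt_or_ge t i with h | h
    · exact le_step _ (hK.stable _ _ (mem_step_gt h hx))
    · obtain ⟨n, hn⟩ := Int.eq_ofNat_of_zero_le (sub_nonneg.2 h)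
      obtain ⟨y, hy, a, rfl⟩ := mem_step (n := n) (by omega) hx
      rw [map_add, map_smul, pow_succ_app]
      exact add_mem (le_step _ (hK.stable _ _ hy))
        (Submodule.smul_mem _ _ (pow_mem_step _ (by push_cast; omega)))

lemma Reach.isFam (hG : IsFam T G G) (h : Reach T U G K) : IsFam T G K := by
  induction h with
  | bot => exact ⟨fun _ => bot_le, fun i x hx => by
      rw [Submodule.mem_bot] at hx; subst hx; simp⟩
  | step_s10 K t v _ hv ih => exact hG.step_s10 ih hv.1

lemma Reach.low (hT6 : T ^ 6 = 0) (hG : IsFam T G G) (h : Reach T U G K) :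
    ∀ i ≤ 0, K i = ⊥ := by
  induction h with
  | bot => intros; rfl
  | step_s10 K t v hK hv ih =>
    intro i hi
    have hF := hK.isFam hG
    have key : t ≤ 3 ∨ ∀ n : ℕ, i = t - n → (T ^ n) v = 0 := by
      right
      intro n hn
      have aux : ∀ (m : ℕ) (j : ℤ), m ≤ n → j = t - m → (T ^ m) v ∈ K j → (T ^ n) v = 0 := by
        intro m j hm hj h
        have h1 := hF.pow (n - m) (j := i) (by omega) h
        rw [pow_add_app, ih i hi, Submodule.mem_bot] at h1
        rwa [Nat.sub_add_cancel hm] at h1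
      rcases hv.2 with h | ⟨h, h'⟩ | ⟨h, h'⟩ | ⟨h, h'⟩ | ⟨h, -, h'⟩
      · exact pow_zero_of_six hT6 (by omega) v
      · exact aux 1 4 (by omega) (by omega) (by simpa using h')
      · exact pow_zero_of_six hT6 (by omega) v
      · exact aux 5 2 (by omega) (by omega) h'
      · exact aux 1 3 (by omega) (by omega) (by simpa using h')
    have ht : 4 ≤ t := by
      rcases hv.2 with h | ⟨h, h'⟩ | ⟨h, h'⟩ | ⟨h, h'⟩ | ⟨h, -, h'⟩ <;> omega
    rw [eq_bot_iff]
    intro x hx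
    obtain ⟨n, hn⟩ := Int.eq_ofNat_of_zero_le (show 0 ≤ t - i by omega)
    obtain ⟨y, hy, a, rfl⟩ := mem_step (n := n) (by omega) hx
    rcases key with h | h
    · omega
    · rw [h n (by omega), smul_zero, add_zero]
      rwa [ih i hi] at hy

/-- The splitting step: remove the cyclic module generated by `v`. -/
lemma Good_s10.split (hTU : ∀ x ∈ U, T x ∈ U) (hG : IsFam T G G)
    (hK : IsFam T G K) {t : ℤ} {v : V} (hv : v ∈ G t)
    (hZ : Good_s10 T U G N (step_s10 T K t v) Z) (m m' : ℕ) (hm' : m' ≤ m + 1)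
    (hm : (T ^ (m + 1)) v ∈ K (t - (m + 1 : ℕ)))
    (hmU : (T ^ m') v ∈ (U ⊓ G (t - m')) ⊔ K (t - m'))
    (hc : ∀ y ∈ K (t - m), ∀ x ∈ Z (t + 1), ∀ u ∈ U ⊓ Z (t - m' + 1),
      (T ^ m) v ≠ y + (T ^ (m + 1)) x + (T ^ (m + 1 - m')) u) :
    ∃ Z', Good_s10 T U G N K Z' := by
  classical
  set W : Submodule k V := K (t - m) ⊔ (Z (t + 1)).map (T ^ (m + 1)) ⊔
    (U ⊓ Z (t - m' + 1)).map (T ^ (m + 1 - m')) with hW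
  have hcW : (T ^ m) v ∉ W := by
    intro h
    obtain ⟨p, hp, q, ⟨u, hu, rfl⟩, hpq⟩ := Submodule.mem_sup.1 h
    obtain ⟨y, hy, q, ⟨x, hx, rfl⟩, rfl⟩ := Submodule.mem_sup.1 hp
    exact hc y hy x hx u hu hpq.symm
  obtain ⟨l0, hl0, hl0W⟩ := Submodule.exists_le_ker_of_notMem hcW
  obtain ⟨l, hl1, hlW⟩ : ∃ l : V →ₗ[k] k, l ((T ^ m) v) = 1 ∧ ∀ w ∈ W, l w = 0 :=
    ⟨(l0 ((T ^ m) v))⁻¹ • l0, by simp [hl0], fun w hw => by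
      have : l0 w = 0 := hl0W hw
      simp [this]⟩
  have hlK : ∀ y ∈ K (t - m), l y = 0 := fun y hy =>
    hlW y (Submodule.mem_sup_left (Submodule.mem_sup_left hy))
  have hlZ : ∀ x ∈ Z (t + 1), l ((T ^ (m + 1)) x) = 0 := fun x hx =>
    hlW _ (Submodule.mem_sup_left (Submodule.mem_sup_right ⟨x, hx, rfl⟩))
  have hlU : ∀ u ∈ U ⊓ Z (t - m' + 1), l ((T ^ (m + 1 - m')) u) = 0 := fun u hu =>
    hlW _ (Submodule.mem_sup_right ⟨u, hu, rfl⟩)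
  have hK'Z : ∀ i, step_s10 T K t v i ≤ Z i := fun i => by rw [← hZ.inf i]; exact inf_le_left
  have hK'N : ∀ i, step_s10 T K t v i ≤ N i := fun i => by rw [← hZ.inf i]; exact inf_le_right
  have hKZ : ∀ i, K i ≤ Z i := fun i => (le_step i).trans (hK'Z i)
  have hKN : ∀ i, K i ≤ N i := fun i => (le_step i).trans (hK'N i)
  -- the new family
  let Z' : ℤ → Submodule k V := fun i =>
    { carrier := {z | z ∈ Z i ∧ ∀ n : ℕ, i = t - m + n → l ((T ^ n) z) = 0}
      zero_mem' := ⟨zero_mem _, fun n _ => by simp⟩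
      add_mem' := by
        rintro a b ⟨ha, ha'⟩ ⟨hb, hb'⟩
        exact ⟨add_mem ha hb, fun n hn => by rw [map_add, map_add, ha' n hn, hb' n hn, add_zero]⟩
      smul_mem' := by
        rintro c a ⟨ha, ha'⟩
        exact ⟨Submodule.smul_mem _ _ ha, fun n hn => by
          rw [map_smul, map_smul, ha' n hn, smul_zero]⟩ }
  have memZ' : ∀ i z, z ∈ Z' i ↔ z ∈ Z i ∧ ∀ n : ℕ, i = t - m + n → l ((T ^ n) z) = 0 :=
    fun i z => Iff.rfl
  have memZ'1 : ∀ i z, ∀ n : ℕ, i = t - m + n → z ∈ Z i → l ((T ^ n) z) = 0 → z ∈ Z' i := by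
    intro i z n hn hz h
    refine (memZ' i z).2 ⟨hz, fun n' hn' => ?_⟩
    have : n' = n := by omega
    rwa [this]
  have memZ'0 : ∀ i z, i < t - m → z ∈ Z i → z ∈ Z' i := by
    intro i z hn hz
    exact (memZ' i z).2 ⟨hz, fun n' hn' => by omega⟩
  have memZ'top : ∀ i z, t < i → z ∈ Z i → z ∈ Z' i := by
    intro i z hn hz
    refine (memZ' i z).2 ⟨hz, fun n' hn' => ?_⟩
    have h1 : n' = (m + 1) + (n' - (m + 1)) := by omega
    rw [h1, ← pow_add_app]
    exact hlZ _ (hZ.fam.pow _ (by omega) hz)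
  have hKZ' : ∀ i, K i ≤ Z' i := fun i y hy =>
    (memZ' i y).2 ⟨hKZ i hy, fun n hn => hlK _ (hK.pow n (by omega) hy)⟩
  refine ⟨Z', ⟨⟨fun i z hz => hZ.fam.le i hz.1, fun i z hz => ?_⟩, fun i => ?_, fun i => ?_,
    fun i => ?_⟩⟩
  · refine (memZ' _ _).2 ⟨hZ.fam.stable i z hz.1, fun n hn => ?_⟩
    have := hz.2 (n + 1) (by push_cast; omega)
    rwa [← pow_add_app, pow_one] at this
  · apply le_antisymm
    · rintro z ⟨hz, hzN⟩
      have hz' : z ∈ step_s10 T K t v i := by rw [← hZ.inf i]; exact ⟨hz.1, hzN⟩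
      rcases lt_or_ge t i with h | h
      · exact mem_step_gt h hz'
      · obtain ⟨n, hn⟩ := Int.eq_ofNat_of_zero_le (sub_nonneg.2 h)
        obtain ⟨y, hy, a, rfl⟩ := mem_step (n := n) (by omega) hz'
        rcases le_or_gt n m with h' | h'
        · have h2 := hz.2 (m - n) (by omega)
          rw [map_add, map_smul, pow_add_app, Nat.sub_add_cancel h', map_add, map_smul, hl1,
            hlK _ (hK.pow (m - n) (by omega) hy)] at h2
          have ha : a = 0 := by simpa using h2
          simpa [ha] using hy
        · refine add_mem hy (Submodule.smul_mem _ _ ?_)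
          have := hK.pow (n - (m + 1)) (j := i) (by omega) hm
          rwa [pow_add_app, Nat.sub_add_cancel h'] at this
    · exact le_inf (hKZ' i) (hKN i)
  · have : Z i ≤ Z' i ⊔ N i := by
      intro z hz
      rcases lt_or_ge t i with h | h
      · exact Submodule.mem_sup_left (memZ'top i z h hz)
      rcases lt_or_ge i (t - m) with h' | h'
      · exact Submodule.mem_sup_left (memZ'0 i z h' hz)
      obtain ⟨n, hn⟩ := Int.eq_ofNat_of_zero_le (sub_nonneg.2 h)
      have hnm : n ≤ m := by omega
      have hvS := pow_mem_step (T := T) (K := K) (v := v) (t := t) (i := i) n (by omega)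
      have e : z = (z - l ((T ^ (m - n)) z) • (T ^ n) v) + l ((T ^ (m - n)) z) • (T ^ n) v := by
        abel
      rw [e]
      refine add_mem (Submodule.mem_sup_left (memZ'1 i _ (m - n) (by omega) ?_ ?_))
        (Submodule.mem_sup_right (Submodule.smul_mem _ _ (hK'N i hvS)))
      · exact sub_mem hz (Submodule.smul_mem _ _ (hK'Z i hvS))
      · rw [map_sub, map_smul, pow_add_app, Nat.sub_add_cancel hnm, map_sub, map_smul, hl1]
        simp
    exact (hZ.sup i).trans (sup_le this le_sup_right)
  · have : U ⊓ Z i ≤ (U ⊓ Z' i) ⊔ (U ⊓ N i) := by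
      rintro u ⟨huU, hu⟩
      rcases lt_or_ge i (t - m) with h' | h'
      · exact Submodule.mem_sup_left ⟨huU, memZ'0 i u h' hu⟩
      rcases lt_or_ge (t - m') i with h | h
      · refine Submodule.mem_sup_left ⟨huU, ?_⟩
        refine (memZ' i u).2 ⟨hu, fun n hn => ?_⟩
        have h1 : n = (m + 1 - m') + (n - (m + 1 - m')) := by omega
        rw [h1, ← pow_add_app]
        exact hlU _ ⟨pow_U hTU _ huU, hZ.fam.pow _ (by omega) hu⟩
      obtain ⟨n, hn⟩ := Int.eq_ofNat_of_zero_le (show 0 ≤ t - i by omega)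
      have hnm : n ≤ m := by omega
      have hvS := pow_mem_step (T := T) (K := K) (v := v) (t := t) (i := i) n (by omega)
      obtain ⟨w, ⟨hwU, hwG⟩, y, hy, hwy⟩ := Submodule.mem_sup.1 hmU
      set w' := (T ^ (n - m')) w with hw'
      set y' := (T ^ (n - m')) y with hy'
      have hy'K : y' ∈ K i := hK.pow _ (by omega) hy
      have hw'U : w' ∈ U := pow_U hTU _ hwU
      have hwy' : w' + y' = (T ^ n) v := by
        rw [hw', hy', ← map_add, hwy, pow_add_app, Nat.sub_add_cancel (by omega)]
      have hw'S : w' ∈ step_s10 T K t v i := by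
        rw [eq_sub_of_add_eq hwy']; exact sub_mem hvS (le_step i hy'K)
      have hlw : l ((T ^ (m - n)) w') = 1 := by
        rw [eq_sub_of_add_eq hwy', map_sub, pow_add_app, Nat.sub_add_cancel hnm, map_sub, hl1,
          hlK _ (hK.pow (m - n) (by omega) hy'K), sub_zero]
      have e : u = (u - l ((T ^ (m - n)) u) • w') + l ((T ^ (m - n)) u) • w' := by
        abel
      rw [e]
      refine add_mem (Submodule.mem_sup_left ⟨sub_mem huU (Submodule.smul_mem _ _ hw'U),
        memZ'1 i _ (m - n) (by omega) ?_ ?_⟩)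
        (Submodule.mem_sup_right ⟨Submodule.smul_mem _ _ hw'U,
          Submodule.smul_mem _ _ (hK'N i hw'S)⟩)
      · exact sub_mem hu (Submodule.smul_mem _ _ (hK'Z i hw'S))
      · rw [map_sub, map_smul, map_sub, map_smul, hlw]
        simp
    exact (hZ.U_le i).trans (sup_le this le_sup_right)

/-- Families to which no elementary element can be added. -/
def Closed (T : V →ₗ[k] V) (U : Submodule k V) (G N : ℤ → Submodule k V) : Prop :=
  ∀ t v, Elem T U G N t v → v ∈ N t

lemma Closed.U_inj (hN : IsFam T G N) (hc : Closed T U G N) (hTU : ∀ x ∈ U, T x ∈ U)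
    (hG : IsFam T G G)
    {d : ℤ} (hd : 4 ≤ d) {u : V} (hu : u ∈ U) (huG : u ∈ G d) (hTu : T u ∈ N (d - 1)) :
    u ∈ N d := by
  rcases lt_or_ge d 8 with h | h
  · obtain rfl | rfl | rfl | rfl : d = 4 ∨ d = 5 ∨ d = 6 ∨ d = 7 := by omega
    · exact hc _ _ ⟨huG, by right; right; right; right; exact ⟨rfl, hu, hTu⟩⟩
    · exact hc _ _ ⟨huG, by right; left; exact ⟨rfl, hTu⟩⟩
    · exact hc _ _ ⟨huG, by
        right; right; left; exact ⟨rfl, Submodule.mem_sup_right hTu⟩⟩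
    · have h5 : (T ^ 5) u ∈ N 2 := by
        have := hN.pow 4 (j := 2) (by norm_num) hTu
        have e : (T ^ 4) (T u) = (T ^ 5) u := by
          have := pow_add_app (T := T) 4 1 u
          simpa using this
        rwa [e] at this
      exact hc _ _ ⟨huG, by right; right; right; left; exact ⟨rfl, h5⟩⟩
  · exact hc _ _ ⟨huG, by left; exact h⟩

lemma Closed.U_inj_pow (hN : IsFam T G N) (hc : Closed T U G N) (hTU : ∀ x ∈ U, T x ∈ U)
    (hG : IsFam T G G) (n : ℕ) :
    ∀ {d : ℤ}, 3 ≤ d - n → ∀ {u : V}, u ∈ U → u ∈ G d → (T ^ n) u ∈ N (d - n) →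
    u ∈ N d := by
  induction n with
  | zero => intro d hd u hu huG h; simpa using h
  | succ n ih =>
    intro d hd u hu huG h
    push_cast at hd
    refine hc.U_inj hN hTU hG (by omega) hu huG
      (ih (d := d - 1) (by omega) (hTU _ hu) (hG.stable _ _ huG) ?_)
    have e : d - 1 - (n : ℤ) = d - ((n + 1 : ℕ) : ℤ) := by push_cast; ring
    rw [e, ← pow_one T, ← pow_mul, one_mul, pow_add_app]
    simpa using h

/-- The key numerical check. -/
lemma Closed.key (hT6 : T ^ 6 = 0) (hTU : ∀ x ∈ U, T x ∈ U) (hG : IsFam T G G)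
    (hN : IsFam T G N) (hc : Closed T U G N) {t : ℤ} {v : V} (hv : Elem T U G K t v)
    (m m' : ℕ) (hm' : m' ≤ m + 1) (hvm : (T ^ m) v ∉ K (t - m))
    (hvm' : ∀ n < m', (T ^ n) v ∉ (U ⊓ G (t - n)) ⊔ K (t - n))
    (hK : IsFam T G K)
    {x u : V} (hx : x ∈ G (t + 1)) (hu : u ∈ U) (huG : u ∈ G (t - m' + 1))
    (hu0 : m' = 0 → u = 0)
    (h : (T ^ (m + 1)) x + (T ^ (m + 1 - m')) u ∈ N (t - m)) :
    ((T ^ (m + 1)) x = 0 ∨ x ∈ N (t + 1)) ∧ u ∈ N (t - m' + 1) := by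
  have small : ∀ n : ℕ, (T ^ n) v ∈ K (t - n) → m < n := by
    intro n hn
    by_contra hlt
    push Not at hlt
    apply hvm
    have := hK.pow (m - n) (j := t - m) (by omega) hn
    rwa [pow_add_app, Nat.sub_add_cancel hlt] at this
  have small' : ∀ n : ℕ, (T ^ n) v ∈ (U ⊓ G (t - n)) ⊔ K (t - n) → m' ≤ n := by
    intro n hn
    by_contra hlt
    push Not at hlt
    exact hvm' n hlt hn
  -- the case of large degrees
  have big : 7 ≤ t → 3 ≤ t - m → 
      ((T ^ (m + 1)) x = 0 ∨ x ∈ N (t + 1)) ∧ u ∈ N (t - m' + 1) := by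
    intro ht htm
    have hxN : x ∈ N (t + 1) := hc _ _ ⟨hx, Or.inl (by omega)⟩
    refine ⟨Or.inr hxN, ?_⟩
    have h1 : (T ^ (m + 1)) x ∈ N (t - m) := hN.pow _ (by push_cast; ring) hxN
    have h2 := sub_mem h h1
    rw [add_sub_cancel_left] at h2
    refine hc.U_inj_pow hN hTU hG (m + 1 - m') (by omega) hu huG ?_
    have e : t - m' + 1 - ((m + 1 - m' : ℕ) : ℤ) = t - m := by omega
    rwa [e]
  have U6 : ∀ w ∈ U, w ∈ G 6 → w ∈ N 6 := fun w hw hwG =>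
    hc _ _ ⟨hwG, by
      right; right; left
      exact ⟨rfl, Submodule.mem_sup_left ⟨hTU _ hw, hG.stable _ _ hwG⟩⟩⟩
  rcases hv with ⟨hvG, h8 | ⟨rfl, h5⟩ | ⟨rfl, h6⟩ | ⟨rfl, h7⟩ | ⟨rfl, h4, h4'⟩⟩
  · have : m < 6 := small 6 (by rw [hT6]; simp)
    exact big (by omega) (by omega)
  · have hm : m < 1 := small 1 (by simpa using h5)
    obtain rfl : m = 0 := by omega
    have C2 : ∀ w ∈ G 6, T w ∈ (U ⊓ G 5) ⊔ N 5 → w ∈ N 6 := fun w hw hw' =>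
      hc _ _ ⟨hw, by right; right; left; exact ⟨rfl, hw'⟩⟩
    norm_num at hx h
    rcases Nat.eq_zero_or_pos m' with h0 | h0
    · have := hu0 h0; subst this
      refine ⟨Or.inr (C2 x hx (Submodule.mem_sup_right (by simpa using h))), zero_mem _⟩
    · obtain rfl : m' = 1 := by omega
      norm_num at huG h ⊢
      have hxN : x ∈ N 6 := C2 x hx (by
        rw [← add_sub_cancel_right (T x) u, sub_eq_add_neg, add_comm]
        exact Submodule.add_mem_sup ⟨neg_mem hu, neg_mem huG⟩ h)
      refine ⟨Or.inr hxN, ?_⟩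
      have h1 := hN.stable _ _ hxN
      norm_num at h1
      have h2 := sub_mem h h1
      rwa [add_sub_cancel_left] at h2
  · have hm : m < 6 := small 6 (by rw [hT6]; simp)
    have hm1 : m' ≤ 1 := small' 1 (by simpa using h6)
    have huN : u ∈ N (6 - m' + 1) := by
      rcases Nat.eq_zero_or_pos m' with h0 | h0
      · rw [hu0 h0]; exact zero_mem _
      · obtain rfl : m' = 1 := by omega
        norm_num at huG ⊢
        exact U6 u hu huG
    refine ⟨?_, huN⟩
    have h1 := sub_mem h (hN.pow (m + 1 - m') (j := 6 - m) (by omega) huN)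
    rw [add_sub_cancel_right] at h1
    rcases Nat.lt_or_ge m 5 with h5 | h5
    · right
      refine hc _ _ ⟨hx, ?_⟩
      right; right; right; left
      refine ⟨by norm_num, ?_⟩
      have h2 := hN.pow (4 - m) (j := 2) (by omega) h1
      rw [pow_add_app] at h2
      have e : 4 - m + (m + 1) = 5 := by omega
      rwa [e] at h2
    · left
      exact pow_zero_of_six hT6 (by omega) x
  · have hm : m < 5 := small 5 (by simpa using h7)
    exact big (by omega) (by omega)
  · have hm : m < 1 := small 1 (by simpa using h4')
    obtain rfl : m = 0 := by omega
    have hm1 : m' ≤ 0 := small' 0 (by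
      simp only [pow_zero, Module.End.one_apply]
      exact Submodule.mem_sup_left ⟨h4, by simpa using hvG⟩)
    obtain rfl : m' = 0 := by omega
    have := hu0 rfl; subst this
    refine ⟨Or.inr (hc _ _ ⟨hx, ?_⟩), zero_mem _⟩
    right; left
    refine ⟨by norm_num, ?_⟩
    simpa using h

lemma Good_s10.descend (hT6 : T ^ 6 = 0) (hTU : ∀ x ∈ U, T x ∈ U) (hG : IsFam T G G)
    (hN : IsFam T G N) (hc : Closed T U G N) (hR : Reach T U G K) :
    ∀ Z, Good_s10 T U G N K Z → ∃ Z', Good_s10 T U G N (fun _ => ⊥) Z' := by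
  classical
  induction hR with
  | bot => exact fun Z hZ => ⟨Z, hZ⟩
  | step_s10 K t v hR hv ih =>
    intro Z hZ
    have hK := hR.isFam hG
    have hK'Z : ∀ i, step_s10 T K t v i ≤ Z i := fun i => by rw [← hZ.inf i]; exact inf_le_left
    have hK'N : ∀ i, step_s10 T K t v i ≤ N i := fun i => by rw [← hZ.inf i]; exact inf_le_right
    have hKN : ∀ i, K i ≤ N i := fun i => (le_step i).trans (hK'N i)
    suffices h : ∃ Z', Good_s10 T U G N K Z' by
      obtain ⟨Z', hZ'⟩ := h
      exact ih Z' hZ'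
    have ex : ∃ n : ℕ, (T ^ n) v ∈ K (t - n) := ⟨6, by rw [hT6]; simp⟩
    rcases Nat.eq_zero_or_pos (Nat.find ex) with h0 | h0
    · -- nothing to add
      have hvK : v ∈ K t := by
        have := Nat.find_spec ex
        rw [h0] at this
        simpa using this
      have e : step_s10 T K t v = K := by
        funext i
        refine le_antisymm (sup_le le_rfl (Submodule.span_le.2 ?_)) (le_step i)
        rintro x ⟨n, hi, rfl⟩
        exact hK.pow n hi hvK
      rw [e] at hZ
      exact ⟨Z, hZ⟩
    · obtain ⟨m, hm⟩ : ∃ m, Nat.find ex = m + 1 := ⟨_, (Nat.succ_pred_eq_of_pos h0).symm⟩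
      have hm1 : (T ^ (m + 1)) v ∈ K (t - (m + 1 : ℕ)) := by
        have := Nat.find_spec ex
        rwa [hm] at this
      have hm0 : (T ^ m) v ∉ K (t - m) := Nat.find_min ex (by omega)
      have ex' : ∃ n : ℕ, (T ^ n) v ∈ (U ⊓ G (t - n)) ⊔ K (t - n) :=
        ⟨m + 1, Submodule.mem_sup_right hm1⟩
      obtain ⟨m', hmm'⟩ : ∃ m', Nat.find ex' = m' := ⟨_, rfl⟩
      have hm'le : m' ≤ m + 1 := by
        rw [← hmm']; exact Nat.find_min' ex' (Submodule.mem_sup_right hm1)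
      have hm'1 : (T ^ m') v ∈ (U ⊓ G (t - m')) ⊔ K (t - m') := by
        have := Nat.find_spec ex'
        rwa [hmm'] at this
      have hm'0 : ∀ n < m', (T ^ n) v ∉ (U ⊓ G (t - n)) ⊔ K (t - n) := fun n hn =>
        Nat.find_min ex' (by omega)
      refine hZ.split hTU hG hK hv.1 m m' hm'le hm1 hm'1 ?_
      -- main contradiction, with `u = 0` when `m' = 0`
      have main : ∀ y ∈ K (t - m), ∀ x ∈ Z (t + 1), ∀ u ∈ U ⊓ Z (t - m' + 1), (m' = 0 → u = 0) →
          (T ^ m) v ≠ y + (T ^ (m + 1)) x + (T ^ (m + 1 - m')) u := by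
        rintro y hy x hx u ⟨huU, huZ⟩ hu0 heq
        have hN1 : (T ^ (m + 1)) x + (T ^ (m + 1 - m')) u ∈ N (t - m) := by
          have h1 : (T ^ m) v ∈ N (t - m) := hK'N _ (pow_mem_step m rfl)
          have h2 := sub_mem h1 (hKN _ hy)
          rw [heq] at h2
          convert h2 using 1
          abel
        obtain ⟨hxN, huN⟩ := hc.key hT6 hTU hG hN hv m m' hm'le hm0 hm'0 hK
          (hZ.fam.le _ hx) huU (hZ.fam.le _ huZ) hu0 hN1
        have hxK : (T ^ (m + 1)) x ∈ K (t - m) := by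
          rcases hxN with h | h
          · rw [h]; exact zero_mem _
          · have : x ∈ step_s10 T K t v (t + 1) := by rw [← hZ.inf]; exact ⟨hx, h⟩
            exact hK.pow _ (by push_cast; ring) (mem_step_gt (by omega) this)
        have huK : u ∈ K (t - m' + 1) := by
          have hus : u ∈ step_s10 T K t v (t - m' + 1) := by rw [← hZ.inf]; exact ⟨huZ, huN⟩
          rcases Nat.eq_zero_or_pos m' with h | h
          · rw [hu0 h]; exact zero_mem _
          · obtain ⟨w, hw, a, hwa⟩ := mem_step (n := m' - 1) (by omega) hus
            by_cases ha : a = 0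
            · rw [hwa, ha]; simpa using hw
            · exfalso
              apply hm'0 (m' - 1) (by omega)
              have e : t - ((m' - 1 : ℕ) : ℤ) = t - m' + 1 := by omega
              rw [e]
              have : (T ^ (m' - 1)) v = a⁻¹ • u + -(a⁻¹ • w) := by
                rw [hwa, smul_add, smul_smul, inv_mul_cancel₀ ha, one_smul]
                abel
              rw [this]
              exact Submodule.add_mem_sup ⟨Submodule.smul_mem _ _ huU,
                Submodule.smul_mem _ _ (hZ.fam.le _ huZ)⟩ (neg_mem (Submodule.smul_mem _ _ hw))
        apply hm0
        rw [heq]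
        exact add_mem (add_mem hy hxK) (hK.pow _ (by omega) huK)
      intro y hy x hx u hu
      rcases Nat.eq_zero_or_pos m' with h | h
      · subst h
        have := main y hy (x + u) (add_mem hx (by simpa using hu.2)) 0 (zero_mem _) (fun _ => rfl)
        simpa [add_assoc] using this
      · exact main y hy x hx u hu (fun h' => by omega)

lemma mem_of_iSup (hind : iSupIndep G) (hK : ∀ i, K i ≤ G i) {t : ℤ} {x : V}
    (hx : x ∈ ⨆ i, K i) (hxG : x ∈ G t) : x ∈ K t := by
  have h1 : (⨆ i, K i) ≤ K t ⊔ ⨆ (j) (_ : j ≠ t), G j := by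
    refine iSup_le fun i => ?_
    by_cases h : i = t
    · subst h; exact le_sup_left
    · exact le_sup_of_le_right ((hK i).trans (le_iSup₂_of_le i h le_rfl))
  obtain ⟨a, ha, b, hb, rfl⟩ := Submodule.mem_sup.1 (h1 hx)
  have hbG : b ∈ G t := by
    have := sub_mem hxG (hK t ha)
    rwa [add_sub_cancel_left] at this
  have : b = 0 := by
    have := Submodule.disjoint_def.1 (hind t) b hbG hb
    exact this
  rw [this, add_zero]; exact ha

lemma exists_closed [FiniteDimensional k V] (hind : iSupIndep G) (hG : IsFam T G G) :
    ∃ N, Reach T U G N ∧ Closed T U G N := by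
  obtain ⟨S, ⟨N, hN, rfl⟩, hmax⟩ := WellFounded.has_min
    (wellFounded_gt (α := Submodule k V))
    {S | ∃ N, Reach T U G N ∧ S = ⨆ i, N i} ⟨_, _, Reach.bot, rfl⟩
  refine ⟨N, hN, fun t v hv => ?_⟩
  have h1 : ¬ (⨆ i, N i) < ⨆ i, step_s10 T N t v i := hmax _ ⟨_, Reach.step_s10 N t v hN hv, rfl⟩
  have h2 : (⨆ i, N i) ≤ ⨆ i, step_s10 T N t v i := iSup_mono fun i => le_step i
  have h3 : (⨆ i, N i) = ⨆ i, step_s10 T N t v i := by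
    by_contra hne
    exact h1 (lt_of_le_of_ne h2 hne)
  refine mem_of_iSup hind (hN.isFam hG).le ?_ hv.1
  rw [h3]
  refine Submodule.mem_iSup_of_mem t ?_
  have := pow_mem_step (T := T) (K := N) (v := v) (t := t) (i := t) 0 (by simp)
  simpa using this

lemma disjoint_iSup (hind : iSupIndep G) (hN : ∀ i, N i ≤ G i) (hZ : ∀ i, Z i ≤ G i)
    (h : ∀ i, Z i ⊓ N i = ⊥) : Disjoint (⨆ i, N i) (⨆ i, Z i) := by
  classical
  rw [Submodule.disjoint_def]
  intro x hx hx'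
  obtain ⟨f, rfl⟩ := (Submodule.mem_iSup_iff_exists_dfinsupp' N x).1 hx
  obtain ⟨g, hg⟩ := (Submodule.mem_iSup_iff_exists_dfinsupp' Z _).1 hx'
  let f' : Π₀ i, G i := f.mapRange (fun i y => ⟨y.1, hN i y.2⟩) (fun i => rfl)
  let g' : Π₀ i, G i := g.mapRange (fun i y => ⟨y.1, hZ i y.2⟩) (fun i => rfl)
  have e1 : (f'.sum fun i y => (y : V)) = f.sum fun i y => (y : V) :=
    DFinsupp.sum_mapRange_index (fun i => rfl)
  have e2 : (g'.sum fun i y => (y : V)) = g.sum fun i y => (y : V) :=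
    DFinsupp.sum_mapRange_index (fun i => rfl)
  have hinj := hind.dfinsupp_lsum_injective
  have hfg : g' = f' := by
    apply hinj
    simp only [DFinsupp.lsum_apply_apply, DFinsupp.sumAddHom_apply]
    exact e2.trans (hg.trans e1.symm)
  have hf0 : f = 0 := by
    ext i
    have h1 : ((g' i : G i) : V) = (f' i : G i) := by rw [hfg]
    have h2 : (g i : V) = (f i : V) := h1
    have h3 : (f i : V) ∈ Z i ⊓ N i := ⟨h2 ▸ (g i).2, (f i).2⟩
    rw [h i, Submodule.mem_bot] at h3
    simpa using h3
  rw [hf0]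
  exact DFinsupp.sum_zero_index

/-- Every graded object splits into a part in degrees `≥ 1` and a part in degrees `≤ 7`. -/
lemma exists_split [FiniteDimensional k V] (hT6 : T ^ 6 = 0) (hTU : ∀ x ∈ U, T x ∈ U)
    (hind : iSupIndep G) (hGT : ∀ i, ∀ x ∈ G i, T x ∈ G (i - 1)) :
    ∃ N Z, IsFam T G N ∧ IsFam T G Z ∧ (∀ i, Z i ⊓ N i = ⊥) ∧ (∀ i, G i ≤ Z i ⊔ N i) ∧
      (∀ i, U ⊓ G i ≤ (U ⊓ Z i) ⊔ (U ⊓ N i)) ∧ (∀ i ≤ 0, N i = ⊥) ∧ (∀ i, 8 ≤ i → G i ≤ N i) := by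
  have hG : IsFam T G G := ⟨fun _ => le_rfl, hGT⟩
  obtain ⟨N, hN, hc⟩ := exists_closed (U := U) hind hG
  have hNf := hN.isFam hG
  have h0 : Good_s10 T U G N N G :=
    ⟨hG, fun i => inf_eq_right.2 (hNf.le i), fun i => le_sup_left, fun i => le_sup_left⟩
  obtain ⟨Z, hZ⟩ := Good_s10.descend hT6 hTU hG hNf hc hN G h0
  exact ⟨N, Z, hNf, hZ.fam, hZ.inf, hZ.sup, hZ.U_le, hN.low hT6 hG,
    fun i hi v hv => hc _ _ ⟨hv, Or.inl hi⟩⟩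

lemma iSup_stable {K : ℤ → Submodule k V} (hK : IsFam T G K) :
    ∀ x ∈ ⨆ i, K i, T x ∈ ⨆ i, K i := by
  intro x hx
  have : (⨆ i, K i) ≤ (⨆ i, K i).comap T :=
    iSup_le fun i y hy => Submodule.mem_iSup_of_mem (i - 1) (hK.stable i y hy)
  exact this hx

end Cov

universe w

theorem cov_dichotomy (k : Type w) [Field k] (M : SCovObj k 6) (hM : M.Indec) (s : ℤ) :
    (∀ i, s + 8 ≤ i → M.grading i = ⊥) ∨ (∀ i ≤ s, M.grading i = ⊥) := by
  set G : ℤ → Submodule k M.carrier := fun i => M.grading (i + s) with hGdef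
  have hind : iSupIndep G := M.indep.comp (add_left_injective s)
  have hGT : ∀ i, ∀ x ∈ G i, M.T x ∈ G (i - 1) := by
    intro i x hx
    have := M.T_grading _ x hx
    have e : i - 1 + s = i + s - 1 := by ring
    simp only [hGdef, e]
    exact this
  have hsup : (⨆ i, G i) = ⊤ := by
    rw [← M.iSup_grading]
    exact (Equiv.addRight s).iSup_comp (g := M.grading)
  have hUsup : M.U = ⨆ i, M.U ⊓ G i := by
    conv_lhs => rw [M.U_grading]
    exact ((Equiv.addRight s).iSup_comp (g := fun i => M.U ⊓ M.grading i)).symm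
  obtain ⟨N, Z, hN, hZ, hinf, hle, hU, hlow, hhigh⟩ :=
    Cov.exists_split M.pow_eq_zero M.maps_U hind hGT
  have hgr : ∀ K : ℤ → Submodule k M.carrier, (∀ i, K i ≤ G i) →
      (⨆ i, K i) = ⨆ j, (⨆ i, K i) ⊓ M.grading j := by
    intro K hK
    refine le_antisymm (iSup_le fun i => ?_) (iSup_le fun j => inf_le_left)
    exact le_iSup_of_le (i + s) (le_inf (le_iSup K i) (hK i))
  by_cases hN0 : (⨆ i, N i) = ⊥
  · left
    intro i hi
    rw [eq_bot_iff, ← hN0]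
    have h1 := hhigh (i - s) (by omega)
    have e : i - s + s = i := by ring
    simp only [hGdef, e] at h1
    exact h1.trans (le_iSup N _)
  by_cases hZ0 : (⨆ i, Z i) = ⊥
  · right
    intro i hi
    have h1 := hle (i - s)
    have e : i - s + s = i := by ring
    have h2 : Z (i - s) = ⊥ := eq_bot_iff.2 (hZ0 ▸ le_iSup Z _)
    rw [hlow (i - s) (by omega), h2, sup_bot_eq] at h1
    simp only [hGdef, e] at h1
    exact eq_bot_iff.2 h1
  exfalso
  refine hM.2 ⟨⨆ i, N i, ⨆ i, Z i, hN0, hZ0, ⟨Cov.disjoint_iSup hind hN.le hZ.le hinf, ?_⟩,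
    Cov.iSup_stable hN, Cov.iSup_stable hZ, ?_, hgr N hN.le, hgr Z hZ.le⟩
  · rw [codisjoint_iff_le_sup, ← hsup]
    refine iSup_le fun i => (hle i).trans (sup_le ?_ ?_)
    · exact le_sup_of_le_right (le_iSup Z i)
    · exact le_sup_of_le_left (le_iSup N i)
  · refine le_antisymm ?_ (sup_le inf_le_left inf_le_left)
    conv_lhs => rw [hUsup]
    refine iSup_le fun i => (hU i).trans (sup_le ?_ ?_)
    · exact le_sup_of_le_right (inf_le_inf_left _ (le_iSup Z i))
    · exact le_sup_of_le_left (inf_le_inf_left _ (le_iSup N i))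

/-- The support of an indecomposable object of `S_k(ñ)` for `n = 6` is contained in an
interval of `8` consecutive indices. -/
theorem stmt10 (k : Type u) [Field k] (M : SCovObj k 6) (hM : M.Indec) :
    ∃ l : ℤ, ∀ i : ℤ, i < l ∨ l + 7 < i → M.grading i = ⊥ := by
  classical
  obtain ⟨v, hv⟩ := hM.1
  have hne : ∃ i, M.grading i ≠ ⊥ := by
    by_contra h
    push Not at h
    apply hv
    have h1 : v ∈ (⨆ i, M.grading i) := by rw [M.iSup_grading]; trivial
    simpa [h] using h1
  obtain ⟨t, ht, hmax⟩ := Set.exists_max_image _ id M.finite_support hne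
  refine ⟨t - 7, fun i hi => ?_⟩
  rcases hi with hi | hi
  · rcases cov_dichotomy k M hM (t - 8) with h | h
    · exact absurd (h t (by omega)) ht
    · exact h i (by omega)
  · by_contra h
    have := hmax i h
    simp only [id] at this
    omega
end
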